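/- arXiv:math/0105262 — 3 statements merged into one kernel-verified Lean document; each statement's English description precedes it below -/
import Mathlib

section
/- The plane quartic curve x³y + y³z + yz³ + z⁴ = 0 over F₂ is smooth and has exactly 1211 F₁₀₂₄-rational points. -/
open MvPolynomial

/-- The plane quartic `x³y + y³z + yz³ + z⁴` over `F₁₀₂₄`. -/
noncomputable def quarticF1024 : MvPolynomial (Fin 3) (GaloisField 2 10) :=
  X 0 ^ 3 * X 1 + X 1 ^ 3 * X 2 + X 1 * X 2 ^ 3 + X 2 ^ 4

/-- The value at `α` of the polynomial over `F₂` coded by the ten low bits of `n`. -/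
def bitVal {R : Type*} [CommRing R] (α : R) (n : ℕ) : R :=
  ∑ i ∈ Finset.range 10, if n.testBit i then α ^ i else 0

/-- Force the evaluation of a natural number before passing it on. -/
def forceNat {β : Type} (n : ℕ) (f : ℕ → β) : β :=
  Nat.rec (f 0) (fun k _ => f (k + 1)) n

theorem forceNat_eq {β : Type} (n : ℕ) (f : ℕ → β) : forceNat n f = f n := by
  cases n <;> rfl

/-- Horner step: multiply by `t` modulo `t¹⁰ + t³ + 1` and add `a` if `u` is `1`. -/
def hornerStep (a c u : ℕ) : ℕ :=
  forceNat c fun c => (((2 * c) % 1024) ^^^ ((c / 512 % 2) * 9)) ^^^ (u * a)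

/-- Multiplication modulo `t¹⁰ + t³ + 1`. -/
def mulAux (a b : ℕ) : ℕ → ℕ → ℕ
  | 0, c => c
  | k + 1, c => mulAux a b k (hornerStep a c (b / 2 ^ k % 2))

def gmul (a b : ℕ) : ℕ :=
  forceNat a fun a => forceNat b fun b => mulAux a b 10 0

/-- The fourth power. -/
def gfour (a : ℕ) : ℕ := forceNat (gmul a a) fun b => gmul b b

/-- The power with exponent `341`. -/
def gpow (a : ℕ) : ℕ :=
  forceNat a fun a =>
  gmul a (gfour (gmul a (gfour (gmul a (gfour (gmul a (gfour a)))))))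

/-- The number of cube roots. -/
def groots (w : ℕ) : ℕ :=
  forceNat w fun w => bif Nat.beq w 0 then 1 else bif Nat.beq (gpow w) 1 then 3 else 0

/-- The right hand side `z⁴ + z³ + z`. -/
def grhs (z : ℕ) : ℕ :=
  (gfour z ^^^ gmul z (gmul z z)) ^^^ z

def gtotal : ℕ → ℕ
  | 0 => 0
  | n + 1 => gtotal n + groots (grhs n)

def gcheck : ℕ → Bool
  | 0 => true
  | n + 1 => (forceNat (gpow (n + 1)) fun p => Nat.beq (gmul p (gmul p p)) 1) && gcheck n

theorem gtotal_eq : gtotal 1024 = 1210 := by decide +kernel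

theorem gcheck_eq : gcheck 1023 = true := by decide +kernel

set_option linter.unusedSectionVars false

section Model

variable {R : Type*} [CommRing R] [CharP R 2] (α : R)

theorem bitVal_xor (a b : ℕ) : bitVal α (a ^^^ b) = bitVal α a + bitVal α b := by
  unfold bitVal
  rw [← Finset.sum_add_distrib]
  refine Finset.sum_congr rfl fun i _ => ?_
  rw [Nat.testBit_xor]
  cases a.testBit i <;> cases b.testBit i <;> simp [CharTwo.add_self_eq_zero]

theorem bitVal_zero : bitVal α 0 = 0 := by simp [bitVal]

theorem bitVal_one : bitVal α 1 = 1 := by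
  simp [bitVal, Finset.sum_range_succ, Nat.testBit, Nat.shiftRight_eq_div_pow]

theorem bitVal_two : bitVal α 2 = α := by
  simp [bitVal, Finset.sum_range_succ, Nat.testBit, Nat.shiftRight_eq_div_pow]

theorem bitVal_nine : bitVal α 9 = α ^ 3 + 1 := by
  simp [bitVal, Finset.sum_range_succ, Nat.testBit, Nat.shiftRight_eq_div_pow]
  ring

theorem bitVal_double (c : ℕ) : bitVal α ((2 * c) % 1024) =
    α * bitVal α c - (if c.testBit 9 then α ^ 10 else 0) := by
  have h : ∀ i, ((2 * c) % 1024).testBit i = (decide (i < 10) && (decide (1 ≤ i) && c.testBit (i - 1))) := by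
    intro i
    rw [show (1024 : ℕ) = 2 ^ 10 by norm_num, Nat.testBit_mod_two_pow,
      show 2 * c = 2 ^ 1 * c by norm_num, Nat.testBit_two_pow_mul]
  unfold bitVal
  simp only [h]
  simp only [Finset.sum_range_succ, Finset.sum_range_zero]
  simp
  simp only [mul_add, mul_ite, mul_zero, ← pow_succ']
  ring_nf

theorem bitVal_hornerStep (hα : α ^ 10 = α ^ 3 + 1) (a c d : ℕ) (j : ℕ) :
    bitVal α (hornerStep a c (d / 2 ^ j % 2)) =
      α * bitVal α c + (if d.testBit j then 1 else 0) * bitVal α a := by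
  have key : ∀ x k : ℕ, x / 2 ^ k % 2 = if x.testBit k then 1 else 0 := by
    intro x k
    rw [Nat.testBit_eq_decide_div_mod_eq]
    have := Nat.mod_two_eq_zero_or_one (x / 2 ^ k)
    rcases this with h | h <;> simp [h]
  rw [hornerStep, forceNat_eq, bitVal_xor, bitVal_xor, bitVal_double, key,
    show (512 : ℕ) = 2 ^ 9 by norm_num, key]
  cases c.testBit 9 <;> cases d.testBit j <;>
    simp [bitVal_zero, bitVal_nine, hα]

theorem bitVal_gmul (hα : α ^ 10 = α ^ 3 + 1) (a b : ℕ) :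
    bitVal α (gmul a b) = bitVal α a * bitVal α b := by
  rw [gmul, forceNat_eq, forceNat_eq]
  simp only [mulAux, bitVal_hornerStep α hα, bitVal_zero]
  conv_rhs => rw [bitVal.eq_def α b]
  simp only [Finset.sum_range_succ, Finset.sum_range_zero]
  have h : ∀ i, (if b.testBit i then α ^ i else 0) = α ^ i * (if b.testBit i then (1 : R) else 0) := by
    intro i; split_ifs <;> simp
  simp only [h]
  ring

theorem bitVal_gfour (hα : α ^ 10 = α ^ 3 + 1) (a : ℕ) :
    bitVal α (gfour a) = bitVal α a ^ 4 := by
  rw [gfour, forceNat_eq, bitVal_gmul α hα, bitVal_gmul α hα]; ring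

theorem bitVal_gpow (hα : α ^ 10 = α ^ 3 + 1) (a : ℕ) :
    bitVal α (gpow a) = bitVal α a ^ 341 := by
  rw [gpow, forceNat_eq]
  simp only [bitVal_gfour α hα, bitVal_gmul α hα]; ring

theorem bitVal_grhs (hα : α ^ 10 = α ^ 3 + 1) (z : ℕ) :
    bitVal α (grhs z) = bitVal α z ^ 4 + bitVal α z ^ 3 + bitVal α z := by
  simp only [grhs, bitVal_xor, bitVal_gfour α hα, bitVal_gmul α hα]; ring

theorem root_pow_card (hα : α ^ 10 = α ^ 3 + 1) : α ^ 1024 = α := by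
  have h : gfour (gfour (gfour (gfour (gfour 2)))) = 2 := by decide +kernel
  have h2 := congrArg (bitVal α) h
  simp only [bitVal_gfour α hα, bitVal_two] at h2
  rw [← h2]
  conv_rhs => simp only [← pow_mul]
  conv_lhs => rw [h2]

theorem gcheck_spec : ∀ N : ℕ, gcheck N = true → ∀ n, 0 < n → n ≤ N →
    gmul (gpow n) (gmul (gpow n) (gpow n)) = 1
  | 0, _, n, h0, h1 => by omega
  | N + 1, h, n, h0, h1 => by
    rw [gcheck, Bool.and_eq_true, forceNat_eq] at h
    rcases Nat.lt_or_ge n (N + 1) with h2 | h2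
    · exact gcheck_spec N h.2 n h0 (by omega)
    · obtain rfl : n = N + 1 := by omega
      exact Nat.eq_of_beq_eq_true h.1

theorem bitVal_ne_zero [Nontrivial R] (hα : α ^ 10 = α ^ 3 + 1) (n : ℕ) (h0 : 0 < n)
    (h1 : n < 1024) : bitVal α n ≠ 0 := by
  intro h
  have h2 := congrArg (bitVal α) (gcheck_spec 1023 gcheck_eq n h0 (by omega))
  simp only [bitVal_gmul α hα, bitVal_gpow α hα, bitVal_one, h] at h2
  simp at h2

theorem bitVal_inj [Nontrivial R] (hα : α ^ 10 = α ^ 3 + 1) (n m : ℕ) (hn : n < 1024)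
    (hm : m < 1024) (h : bitVal α n = bitVal α m) : n = m := by
  by_contra hne
  have h1 : n ^^^ m < 2 ^ 10 := Nat.xor_lt_two_pow (by simpa using hn) (by simpa using hm)
  refine bitVal_ne_zero α hα (n ^^^ m) ?_ (by simpa using h1) ?_
  · exact Nat.pos_of_ne_zero fun h => hne (Nat.xor_eq_zero_iff.mp h)
  · rw [bitVal_xor, h, CharTwo.add_self_eq_zero]

end Model

section Field

variable {K : Type*} [Field K] [Fintype K] [CharP K 2]

theorem exists_root (hK : Fintype.card K = 1024) : ∃ α : K, α ^ 10 = α ^ 3 + 1 := by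
  let L := AlgebraicClosure K
  have : CharP L 2 := charP_of_injective_algebraMap (algebraMap K L).injective 2
  obtain ⟨β, hβ⟩ := IsAlgClosed.exists_root
    (Polynomial.X ^ 10 + Polynomial.X ^ 3 + 1 : Polynomial L) (by
      have : (Polynomial.X ^ 10 + Polynomial.X ^ 3 + 1 : Polynomial L).degree = 10 := by
        compute_degree!
      rw [this]; norm_num)
  have hroot : β ^ 10 = β ^ 3 + 1 := by
    simp only [Polynomial.IsRoot, Polynomial.eval_add, Polynomial.eval_pow, Polynomial.eval_X,
      Polynomial.eval_one] at hβ
    rw [add_assoc] at hβ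
    exact CharTwo.add_eq_zero.mp hβ
  have h1 := root_pow_card β hroot
  have hne : (Polynomial.X ^ 1024 - Polynomial.X : Polynomial L) ≠ 0 :=
    FiniteField.X_pow_card_sub_X_ne_zero L (by norm_num)
  have hmem : ∃ a : K, algebraMap K L a = β := by
    classical
    by_contra hno
    push Not at hno
    have hsub : insert β (Finset.univ.image (algebraMap K L)) ⊆
        (Polynomial.X ^ 1024 - Polynomial.X : Polynomial L).roots.toFinset := by
      intro x hx
      rw [Multiset.mem_toFinset, Polynomial.mem_roots hne]
      simp only [Polynomial.IsRoot, Polynomial.eval_sub, Polynomial.eval_pow, Polynomial.eval_X]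
      rcases Finset.mem_insert.mp hx with rfl | hx
      · rw [h1, sub_self]
      · obtain ⟨a, -, rfl⟩ := Finset.mem_image.mp hx
        rw [← map_pow, ← hK, FiniteField.pow_card, sub_self]
    have hc := Finset.card_le_card hsub
    rw [Finset.card_insert_of_notMem (by simpa using hno),
      Finset.card_image_of_injective _ (algebraMap K L).injective, Finset.card_univ, hK] at hc
    have h3 := Multiset.toFinset_card_le
      (Polynomial.X ^ 1024 - Polynomial.X : Polynomial L).roots
    have h4 := Polynomial.card_roots' (Polynomial.X ^ 1024 - Polynomial.X : Polynomial L)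
    rw [FiniteField.X_pow_card_sub_X_natDegree_eq L (by norm_num)] at h4
    omega
  obtain ⟨a, rfl⟩ := hmem
  refine ⟨a, (algebraMap K L).injective ?_⟩
  simpa using hroot

theorem hornerStep_lt (a c u : ℕ) (ha : a < 1024) (hu : u < 2) : hornerStep a c u < 1024 := by
  rw [hornerStep, forceNat_eq]
  have h1 : (2 * c) % 1024 < 2 ^ 10 := Nat.mod_lt _ (by norm_num)
  have h2 : (c / 512 % 2) * 9 < 2 ^ 10 := by omega
  have h3 : u * a < 2 ^ 10 := by
    have : u ≤ 1 := by omega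
    calc u * a ≤ 1 * a := Nat.mul_le_mul_right a this
      _ < 2 ^ 10 := by omega
  exact Nat.xor_lt_two_pow (Nat.xor_lt_two_pow h1 h2) h3

theorem gmul_lt (a b : ℕ) (ha : a < 1024) : gmul a b < 1024 := by
  rw [gmul, forceNat_eq, forceNat_eq]
  simp only [mulAux]
  exact hornerStep_lt _ _ _ ha (Nat.mod_lt _ (by norm_num))

theorem gfour_lt (a : ℕ) (ha : a < 1024) : gfour a < 1024 := by
  rw [gfour, forceNat_eq]
  exact gmul_lt _ _ (gmul_lt _ _ ha)

theorem gpow_lt (a : ℕ) (ha : a < 1024) : gpow a < 1024 := by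
  rw [gpow, forceNat_eq]
  exact gmul_lt _ _ ha

theorem grhs_lt (z : ℕ) (hz : z < 1024) : grhs z < 1024 := by
  have h1 : gfour z < 2 ^ 10 := gfour_lt z hz
  have h2 : gmul z (gmul z z) < 2 ^ 10 := gmul_lt _ _ hz
  exact Nat.xor_lt_two_pow (Nat.xor_lt_two_pow h1 h2) hz

theorem exists_omega (α : K) (hα : α ^ 10 = α ^ 3 + 1) : ∃ ω : K, ω ^ 2 + ω + 1 = 0 := by
  refine ⟨bitVal α (gpow 2), ?_⟩
  have h : gmul (gpow 2) (gpow 2) ^^^ gpow 2 ^^^ 1 = 0 := by decide +kernel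
  have h2 := congrArg (bitVal α) h
  simp only [bitVal_xor, bitVal_gmul α hα, bitVal_one, bitVal_zero] at h2
  rw [← h2]; ring

theorem card_cube_roots [DecidableEq K] (hK : Fintype.card K = 1024) (ω : K)
    (hω : ω ^ 2 + ω + 1 = 0) (w : K) :
    (Finset.univ.filter fun x : K => x ^ 3 = w).card =
      if w = 0 then 1 else if w ^ 341 = 1 then 3 else 0 := by
  have two : (2 : K) = 0 := CharTwo.two_eq_zero
  split_ifs with h0 h1
  · subst h0
    rw [Finset.card_eq_one]
    exact ⟨0, by ext x; simp⟩
  · have hne : w ^ 114 ≠ 0 := pow_ne_zero _ h0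
    have hc : (w ^ 114) ^ 3 = w := by
      rw [← pow_mul, show 114 * 3 = 341 + 1 by norm_num, pow_succ, h1, one_mul]
    generalize w ^ 114 = y at hne hc
    have hw1 : ω ≠ 1 := by
      rintro rfl
      have : (1 : K) = 0 := by linear_combination hω - two
      exact one_ne_zero this
    have hw0 : ω ≠ 0 := by
      rintro rfl
      simp at hω
    rw [Finset.card_eq_three]
    refine ⟨y, ω * y, ω ^ 2 * y, ?_, ?_, ?_, ?_⟩
    · intro h
      apply hw1
      apply mul_right_cancel₀ hne
      rw [← h, one_mul]
    · intro h
      have h2 : (1 : K) * y = ω ^ 2 * y := by rw [one_mul]; exact h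
      have h3 := mul_right_cancel₀ hne h2
      apply hw0
      linear_combination hω + h3 - two
    · intro h
      have h3 := mul_right_cancel₀ hne h
      apply hw1
      apply mul_left_cancel₀ hw0
      linear_combination - h3
    · ext x
      simp only [Finset.mem_filter, Finset.mem_univ, true_and, Finset.mem_insert,
        Finset.mem_singleton]
      have hfac : x ^ 3 - w = (x - y) * ((x - ω * y) * (x - ω ^ 2 * y)) := by
        rw [← hc]
        linear_combination (x ^ 2 * y - x * y ^ 2 * ω + (ω - 1) * y ^ 3) * hω
      rw [← sub_eq_zero, hfac, mul_eq_zero, mul_eq_zero, sub_eq_zero, sub_eq_zero, sub_eq_zero]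
  · rw [Finset.card_eq_zero, Finset.filter_eq_empty_iff]
    rintro x - rfl
    apply h1
    have hx : x ≠ 0 := by rintro rfl; simp at h0
    rw [← pow_mul, show 3 * 341 = Fintype.card K - 1 by rw [hK]]
    exact FiniteField.pow_card_sub_one_eq_one x hx

theorem groots_eq [DecidableEq K] (α : K) (hα : α ^ 10 = α ^ 3 + 1) (w : ℕ) (hw : w < 1024) :
    groots w = if bitVal α w = 0 then 1 else if bitVal α w ^ 341 = 1 then 3 else 0 := by
  have e0 : bitVal α w = 0 ↔ w = 0 := by
    constructor
    · intro h
      exact bitVal_inj α hα w 0 hw (by norm_num) (by rw [h, bitVal_zero])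
    · rintro rfl; exact bitVal_zero α
  have e1 : bitVal α w ^ 341 = 1 ↔ gpow w = 1 := by
    rw [← bitVal_gpow α hα]
    constructor
    · intro h
      exact bitVal_inj α hα _ 1 (gpow_lt w hw) (by norm_num) (by rw [h, bitVal_one])
    · intro h; rw [h]; exact bitVal_one α
  have eb : ∀ a b : ℕ, Nat.beq a b = decide (a = b) := by
    intro a b
    by_cases h : a = b
    · subst h; simp
    · simp only [h, decide_false]
      cases h2 : Nat.beq a b
      · rfl
      · exact absurd (Nat.eq_of_beq_eq_true h2) h
  rw [groots, forceNat_eq]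
  simp only [e0, e1, eb, Bool.cond_decide]

theorem gtotal_sum (N : ℕ) : gtotal N = ∑ n ∈ Finset.range N, groots (grhs n) := by
  induction N with
  | zero => rfl
  | succ n ih => rw [gtotal, Finset.sum_range_succ, ih]

theorem card_affine [DecidableEq K] (hK : Fintype.card K = 1024) :
    Nat.card {p : K × K // p.1 ^ 3 = p.2 ^ 4 + p.2 ^ 3 + p.2} = 1210 := by
  obtain ⟨α, hα⟩ := exists_root hK
  obtain ⟨ω, hω⟩ := exists_omega α hα
  have hbij : Function.Bijective (fun n : Fin 1024 => bitVal α n.1) := by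
    rw [Fintype.bijective_iff_injective_and_card]
    refine ⟨fun a b h => Fin.ext (bitVal_inj α hα _ _ a.2 b.2 h), ?_⟩
    rw [hK, Fintype.card_fin]
  let e : {p : K × K // p.1 ^ 3 = p.2 ^ 4 + p.2 ^ 3 + p.2} ≃
      Σ z : K, {x : K // x ^ 3 = z ^ 4 + z ^ 3 + z} :=
    { toFun := fun p => ⟨p.1.2, p.1.1, p.2⟩
      invFun := fun q => ⟨(q.2.1, q.1), q.2.2⟩
      left_inv := fun _ => rfl
      right_inv := fun _ => rfl }
  rw [Nat.card_congr e, Nat.card_sigma, ← gtotal_eq, gtotal_sum, Finset.sum_range,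
    ← hbij.sum_comp]
  refine Finset.sum_congr rfl fun n _ => ?_
  rw [groots_eq α hα _ (grhs_lt _ n.2), bitVal_grhs α hα, ← card_cube_roots hK ω hω,
    Nat.card_eq_fintype_card, Fintype.card_subtype]

/-- The quartic form. -/
def quarticForm {F : Type*} [Field F] (v : Fin 3 → F) : F :=
  v 0 ^ 3 * v 1 + v 1 ^ 3 * v 2 + v 1 * v 2 ^ 3 + v 2 ^ 4

theorem quarticForm_smul {F : Type*} [Field F] (c : F) (v : Fin 3 → F) :
    quarticForm (c • v) = c ^ 4 * quarticForm v := by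
  simp [quarticForm]; ring

theorem quarticForm_rep {F : Type*} [Field F] (v : Fin 3 → F) (hv : v ≠ 0) :
    quarticForm (Projectivization.mk F v hv).rep = 0 ↔ quarticForm v = 0 := by
  obtain ⟨a, ha⟩ := Projectivization.exists_smul_eq_mk_rep F v hv
  rw [← ha, Units.smul_def, quarticForm_smul]
  simp

theorem card_projective [DecidableEq K] (hK : Fintype.card K = 1024) :
    Nat.card {P : Projectivization K (Fin 3 → K) // quarticForm P.rep = 0} = 1211 := by
  have h1 : (![1, 0, 0] : Fin 3 → K) ≠ 0 := fun h => by simpa using congrFun h 0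
  have h2 : ∀ x z : K, (![x, 1, z] : Fin 3 → K) ≠ 0 := fun x z h => by simpa using congrFun h 1
  let f : Option {p : K × K // p.1 ^ 3 = p.2 ^ 4 + p.2 ^ 3 + p.2} →
      {P : Projectivization K (Fin 3 → K) // quarticForm P.rep = 0} := fun o =>
    match o with
    | none => ⟨Projectivization.mk K ![1, 0, 0] h1, by
        rw [quarticForm_rep]; simp [quarticForm]⟩
    | some p => ⟨Projectivization.mk K ![p.1.1, 1, p.1.2] (h2 _ _), by
        rw [quarticForm_rep]
        have := p.2
        simp only [quarticForm, Matrix.cons_val_zero, Matrix.cons_val_one, Matrix.cons_val]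
        rw [this]
        have two : (2 : K) = 0 := CharTwo.two_eq_zero
        linear_combination (p.1.2 ^ 4 + p.1.2 ^ 3 + p.1.2) * two⟩
  have hf : Function.Bijective f := by
    constructor
    · rintro (_ | ⟨⟨x, z⟩, hp⟩) (_ | ⟨⟨x₂, z₂⟩, hp₂⟩) h
      · rfl
      · obtain ⟨a, ha⟩ := (Projectivization.mk_eq_mk_iff' K _ _ _ _).mp (congrArg Subtype.val h)
        have e1 := congrFun ha 1
        have e0 := congrFun ha 0
        simp at e0 e1
        simp [e1] at e0
      · obtain ⟨a, ha⟩ := (Projectivization.mk_eq_mk_iff' K _ _ _ _).mp (congrArg Subtype.val h)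
        have e1 := congrFun ha 1
        simp at e1
      · obtain ⟨a, ha⟩ := (Projectivization.mk_eq_mk_iff' K _ _ _ _).mp (congrArg Subtype.val h)
        have e1 := congrFun ha 1
        have e0 := congrFun ha 0
        have e2 := congrFun ha 2
        simp at e0 e1 e2
        subst e1
        simp at e0 e2
        subst e0 e2
        rfl
    · rintro ⟨P, hP⟩
      induction P using Projectivization.ind with
      | h v hv =>
      have hq := (quarticForm_rep v hv).mp hP
      by_cases hy : v 1 = 0
      · have hz : v 2 = 0 := by
          simpa [quarticForm, hy] using hq
        refine ⟨none, Subtype.ext ?_⟩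
        refine Eq.symm ((Projectivization.mk_eq_mk_iff' K _ _ _ _).mpr ⟨v 0, ?_⟩)
        ext i
        fin_cases i <;> simp [hy, hz]
      · have two : (2 : K) = 0 := CharTwo.two_eq_zero
        refine ⟨some ⟨(v 0 / v 1, v 2 / v 1), ?_⟩, Subtype.ext ?_⟩
        · simp only [quarticForm] at hq
          field_simp
          linear_combination hq - (v 2 ^ 4 + v 1 * v 2 ^ 3 + v 1 ^ 3 * v 2) * two
        · refine Eq.symm ((Projectivization.mk_eq_mk_iff' K _ _ _ _).mpr ⟨v 1, ?_⟩)
          ext i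
          fin_cases i <;> simp <;> field_simp
  rw [← Nat.card_congr (Equiv.ofBijective f hf), Finite.card_option, card_affine hK]

end Field

/-- The quartic `x³y + y³z + yz³ + z⁴ = 0` is smooth (no common projective zero
of the curve and its partial derivatives over the algebraic closure) and has
exactly `1211` `F₁₀₂₄`-rational points. -/
theorem stmt_9 :
    (∀ v : Fin 3 → AlgebraicClosure (GaloisField 2 10), v ≠ 0 →
      eval v (MvPolynomial.map
        (algebraMap (GaloisField 2 10) (AlgebraicClosure (GaloisField 2 10)))
        quarticF1024) = 0 →
      ∃ i, eval v (pderiv i (MvPolynomial.map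
        (algebraMap (GaloisField 2 10) (AlgebraicClosure (GaloisField 2 10)))
        quarticF1024)) ≠ 0) ∧
    Nat.card {P : Projectivization (GaloisField 2 10) (Fin 3 → GaloisField 2 10) //
      eval P.rep quarticF1024 = 0} = 1211 := by
  constructor
  · intro v hv h0
    by_contra hno
    push Not at hno
    have hx := hno 0
    have hy := hno 1
    have hz := hno 2
    have : CharP (AlgebraicClosure (GaloisField 2 10)) 2 :=
      charP_of_injective_algebraMap
        (algebraMap (GaloisField 2 10) (AlgebraicClosure (GaloisField 2 10))).injective 2
    have two : (2 : AlgebraicClosure (GaloisField 2 10)) = 0 := CharTwo.two_eq_zero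
    simp [quarticF1024, pderiv_X] at h0 hx hy hz
    have hall : v 0 = 0 → v 1 = 0 → v 2 = 0 → False := by
      intro a b c
      apply hv
      ext i
      fin_cases i <;> simp [a, b, c]
    rcases hx with hx | hx | hx
    · have h2 : v 2 = 0 := by simpa [hx] using h0
      exact hall (by simpa [hx, h2] using hy) hx h2
    · have h1 : (1 : AlgebraicClosure (GaloisField 2 10)) = 0 := by linear_combination hx - two
      exact one_ne_zero h1
    · have h4 : v 2 ^ 4 = 0 := by
        rw [hx] at h0
        linear_combination h0 - v 2 * hz + (v 1 * v 2 ^ 3 + 2 * v 2 ^ 4) * two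
      have h2 : v 2 = 0 := by simpa using h4
      exact hall hx (by simpa [h2] using hz) h2
  · classical
    have := Fintype.ofFinite (GaloisField 2 10)
    have hK : Fintype.card (GaloisField 2 10) = 1024 := by
      rw [← Nat.card_eq_fintype_card, GaloisField.card 2 10 (by norm_num)]
      norm_num
    have h := card_projective hK
    have he : ∀ v : Fin 3 → GaloisField 2 10, eval v quarticF1024 = quarticForm v := by
      intro v; simp [quarticF1024, quarticForm]
    simp only [he]
    exact h
end

section
/- The plane quintic x³y² + y⁵ + x³yz + y³z² + z⁵ = 0 over F₂ has exactly 1343 smooth F₁₀₂₄-rational points, and the point (1:0:0) is a singular point of the curve. -/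
open MvPolynomial

/-- The quintic `x³y² + y⁵ + x³yz + y³z² + z⁵` over `F₁₀₂₄`. -/
noncomputable def quinticF1024 : MvPolynomial (Fin 3) (GaloisField 2 10) :=
  X 0 ^ 3 * X 1 ^ 2 + X 1 ^ 5 + X 0 ^ 3 * X 1 * X 2 + X 1 ^ 3 * X 2 ^ 2 + X 2 ^ 5

set_option linter.unusedSectionVars false

namespace Q
/-- evaluate `f` at the literal value of `n` -/
def force (n : ℕ) (f : ℕ → ℕ) : ℕ := Nat.rec (f 0) (fun m _ => f (Nat.succ m)) n
theorem force_eq (n : ℕ) (f : ℕ → ℕ) : force n f = f n := by cases n <;> rfl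
def xt (a : ℕ) : ℕ := force a fun a => Nat.xor (Nat.mod (Nat.mul 2 a) 1024) (Nat.mul 9 (Nat.mod (Nat.div a 512) 2))
def mulA (a : ℕ) (k : ℕ) : ℕ → ℕ :=
  Nat.rec (fun _ => 0) (fun _ ih b => Nat.xor (Nat.mul (Nat.mod b 2) a) (xt (ih (Nat.div b 2)))) k
def mul (a b : ℕ) : ℕ := force a fun a => force b fun b => mulA a 10 b
def sq (a : ℕ) : ℕ := force a fun a => mul a a
def nm (w : ℕ) : ℕ := force w fun w =>
  force (mul w (sq (sq w))) fun w5 =>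
  force (mul w5 (sq (sq (sq (sq w5))))) fun w85 => mul w (sq (sq w85))
def val (y : ℕ) : ℕ := force y fun y => force (sq y) fun y2 => force (mul y2 y) fun y3 =>
  nm (mul (Nat.xor (Nat.xor (mul y2 y3) y3) 1) (sq (Nat.xor y2 y)))
def G (v : ℕ) : ℕ := force v fun v => bif Nat.beq v 1 then 3 else bif Nat.beq v 0 then 1 else
  bif Nat.beq v 236 then 0 else bif Nat.beq v 237 then 0 else 5000
def run (n : ℕ) : ℕ → ℕ :=
  Nat.rec (fun _ => 0) (fun _ ih y => force y fun y => Nat.add (G (val y)) (ih (xt y))) n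

def it (n : ℕ) : ℕ → ℕ := Nat.rec (fun y => y) (fun _ ih y => force y fun y => ih (xt y)) n

/-- the same sum as `run`, in blocks of length 33 (keeps the recursion shallow) -/
def run2 (n : ℕ) : ℕ → ℕ :=
  Nat.rec (fun _ => 0) (fun _ ih y => force y fun y => Nat.add (run 33 y) (ih (it 33 y))) n

theorem xt_eq (a : ℕ) : xt a = ((2 * a) % 1024) ^^^ (9 * (a / 512 % 2)) := force_eq _ _
theorem mul_eq (a b : ℕ) : mul a b = mulA a 10 b := by
  unfold mul; rw [force_eq, force_eq]
theorem mulA_zero (a b : ℕ) : mulA a 0 b = 0 := rfl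
theorem mulA_succ (a k b : ℕ) :
    mulA a (k + 1) b = ((b % 2) * a) ^^^ xt (mulA a k (b / 2)) := rfl
theorem it_succ (n y : ℕ) : it (n + 1) y = it n (xt y) :=
  force_eq y fun y => it n (xt y)
theorem run_succ (n y : ℕ) : run (n + 1) y = G (val y) + run n (xt y) :=
  force_eq y fun y => G (val y) + run n (xt y)

theorem run2_succ (n y : ℕ) : run2 (n + 1) y = run 33 y + run2 n (it 33 y) :=
  force_eq y fun y => run 33 y + run2 n (it 33 y)

theorem run_add (m n : ℕ) : ∀ y, run (m + n) y = run m y + run n (it m y) := by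
  induction m with
  | zero =>
    intro y
    rw [Nat.zero_add]
    exact (Nat.zero_add _).symm
  | succ m ih =>
    intro y
    rw [Nat.add_right_comm, run_succ, run_succ, it_succ, ih, Nat.add_assoc]

theorem run2_eq (n : ℕ) : ∀ y, run2 n y = run (33 * n) y := by
  induction n with
  | zero => intro y; rfl
  | succ n ih =>
    intro y
    rw [run2_succ, ih, Nat.mul_succ, Nat.add_comm (33 * n), run_add]

theorem run_eq : run 1023 1 = 1341 :=
  (run2_eq 31 1).symm.trans (by decide +kernel)

section ring
variable {R : Type*} [CommRing R] [CharP R 2] (α : R)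

/-- evaluation at `α` of the polynomial whose coefficients are the lowest `k` bits of `n` -/
def ph (α : R) : ℕ → ℕ → R
  | 0, _ => 0
  | k + 1, n => ((n % 2 : ℕ) : R) + α * ph α k (n / 2)

theorem cast_xor (a b : ℕ) : (((a ^^^ b) % 2 : ℕ) : R) = ((a % 2 : ℕ) : R) + ((b % 2 : ℕ) : R) := by
  have h : (a ^^^ b) % 2 = (a + b) % 2 := by
    have := Nat.xor_mod_two_eq (m := a) (n := b)
    exact this
  have key : ∀ n : ℕ, ((n % 2 : ℕ) : R) = (n : R) := fun n => by
    have := CharP.cast_eq_mod R 2 n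
    exact this.symm
  rw [h, key, key, key, Nat.cast_add]

theorem ph_xor (k : ℕ) : ∀ a b : ℕ, ph α k (a ^^^ b) = ph α k a + ph α k b := by
  induction k with
  | zero => intro a b; simp [ph]
  | succ k ih =>
    intro a b
    have h : (a ^^^ b) / 2 = (a / 2) ^^^ (b / 2) := Nat.xor_div_two
    simp only [ph]
    rw [cast_xor, h, ih]
    ring

theorem ph_top (k : ℕ) : ∀ a : ℕ, ph α (k + 1) a = ph α k a + ((a / 2 ^ k % 2 : ℕ) : R) * α ^ k := by
  induction k with
  | zero => intro a; simp [ph]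
  | succ k ih =>
    intro a
    rw [ph, ih, ph, Nat.div_div_eq_div_mul, ← pow_succ']
    ring

theorem ph_mod (k : ℕ) : ∀ a : ℕ, ph α k (a % 2 ^ k) = ph α k a := by
  induction k with
  | zero => intro a; simp [ph]
  | succ k ih =>
    intro a
    have h1 : a % 2 ^ (k + 1) % 2 = a % 2 := Nat.mod_mod_of_dvd _ ⟨2 ^ k, by ring⟩
    have h2 : a % 2 ^ (k + 1) / 2 = a / 2 % 2 ^ k := by
      rw [pow_succ', Nat.mod_mul_right_div_self]
    simp only [ph]
    rw [h1, h2, ih]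

theorem ph_zero (k : ℕ) : ph α k 0 = 0 := by
  induction k with
  | zero => rfl
  | succ k ih => simp [ph, ih]

theorem ph_one : ph α 10 1 = 1 := by simp [ph]

theorem ph_xt (hα : α ^ 10 = α ^ 3 + 1) (a : ℕ) : ph α 10 (xt a) = α * ph α 10 a := by
  rw [xt_eq, ph_xor, show 1024 = 2 ^ 10 from rfl, ph_mod, ph_top α 9 a]
  have h1 : ph α 10 (2 * a) = α * ph α 9 a := by
    rw [ph]; simp
  have h2 : ph α 10 (9 * (a / 512 % 2)) = ((a / 512 % 2 : ℕ) : R) * (α ^ 3 + 1) := by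
    rcases Nat.mod_two_eq_zero_or_one (a / 512) with h | h <;> rw [h]
    · simp [ph_zero]
    · simp [ph]; ring
  rw [h1, h2, ← hα]
  norm_num
  ring

theorem ph_mulA (hα : α ^ 10 = α ^ 3 + 1) (a k : ℕ) :
    ∀ b, ph α 10 (mulA a k b) = ph α 10 a * ph α k b := by
  induction k with
  | zero => intro b; rw [mulA_zero, ph_zero]; simp [ph]
  | succ k ih =>
    intro b
    rw [mulA_succ, ph_xor, ph_xt α hα, ih, ph.eq_2 α b k]
    rcases Nat.mod_two_eq_zero_or_one b with h | h <;> rw [h]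
    · simp [ph_zero]; ring
    · simp; ring

theorem ph_mul (hα : α ^ 10 = α ^ 3 + 1) (a b : ℕ) :
    ph α 10 (mul a b) = ph α 10 a * ph α 10 b := by
  rw [mul_eq, ph_mulA α hα]

theorem ph_sq (hα : α ^ 10 = α ^ 3 + 1) (a : ℕ) : ph α 10 (sq a) = ph α 10 a ^ 2 := by
  unfold sq; rw [force_eq, ph_mul α hα, pow_two]

theorem ph_nm (hα : α ^ 10 = α ^ 3 + 1) (w : ℕ) : ph α 10 (nm w) = ph α 10 w ^ 341 := by
  unfold nm
  simp only [force_eq, ph_mul α hα, ph_sq α hα]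
  ring

theorem ph_val (hα : α ^ 10 = α ^ 3 + 1) (a : ℕ) : ph α 10 (val a) =
    ((ph α 10 a ^ 5 + ph α 10 a ^ 3 + 1) * (ph α 10 a ^ 2 + ph α 10 a) ^ 2) ^ 341 := by
  have hx : ∀ a b : ℕ, ph α 10 (Nat.xor a b) = ph α 10 a + ph α 10 b := ph_xor α 10
  unfold val
  simp only [force_eq]
  rw [ph_nm α hα, ph_mul α hα, ph_sq α hα, hx, hx, hx, ph_mul α hα, ph_mul α hα, ph_sq α hα, ph_one]
  congr 1
  ring

theorem ph_it (hα : α ^ 10 = α ^ 3 + 1) (n : ℕ) : ∀ a, ph α 10 (it n a) = α ^ n * ph α 10 a := by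
  induction n with
  | zero => intro a; simp [it]
  | succ n ih => intro a; rw [it_succ, ih, ph_xt α hα]; ring

theorem ph_pow (hα : α ^ 10 = α ^ 3 + 1) (n : ℕ) : ph α 10 (it n 1) = α ^ n := by
  rw [ph_it α hα, ph_one, mul_one]

theorem ph_ne_one [Nontrivial R] (hα : α ^ 10 = α ^ 3 + 1) (n m : ℕ) (h : mul (n ^^^ 1) m = 1) :
    ph α 10 n ≠ 1 := by
  intro h1
  have := ph_mul α hα (n ^^^ 1) m
  rw [h, ph_xor, h1, ph_one, CharTwo.add_self_eq_zero, zero_mul] at this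
  exact one_ne_zero this

theorem pow_31 (hα : α ^ 10 = α ^ 3 + 1) : α ^ 31 = ph α 10 (it 31 1) := (ph_pow α hα 31).symm

theorem pow_93 (hα : α ^ 10 = α ^ 3 + 1) : α ^ 93 = ph α 10 713 := by
  rw [show 93 = 31 * 3 from rfl, pow_mul, pow_31 α hα, pow_succ, ← ph_sq α hα, ← ph_mul α hα,
    show mul (sq (it 31 1)) (it 31 1) = 713 by decide +kernel]

theorem pow_341 (hα : α ^ 10 = α ^ 3 + 1) : α ^ 341 = ph α 10 237 := by
  have h : α = ph α 10 2 := by simp [ph]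
  conv_lhs => rw [h]
  rw [← ph_nm α hα, show nm 2 = 237 by decide +kernel]

theorem pow_1023 (hα : α ^ 10 = α ^ 3 + 1) : α ^ 1023 = 1 := by
  rw [show 1023 = 341 * 3 from rfl, pow_mul, pow_341 α hα, pow_succ, ← ph_sq α hα,
    ← ph_mul α hα, show mul (sq 237) 237 = 1 by decide +kernel, ph_one]

theorem order [Nontrivial R] (hα : α ^ 10 = α ^ 3 + 1) : orderOf α = 1023 := by
  apply orderOf_eq_of_pow_and_pow_div_prime (by norm_num) (pow_1023 α hα)
  intro p hp hd
  have : p ∈ Nat.primeFactors 1023 := Nat.mem_primeFactors.2 ⟨hp, hd, by norm_num⟩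
  have h3 : p = 3 ∨ p = 11 ∨ p = 31 := by
    rw [show 1023 = 3 * (11 * 31) by norm_num] at hd
    rcases hp.dvd_mul.1 hd with h | h
    · exact Or.inl ((Nat.prime_dvd_prime_iff_eq hp (by norm_num)).1 h)
    rcases hp.dvd_mul.1 h with h | h
    · exact Or.inr (Or.inl ((Nat.prime_dvd_prime_iff_eq hp (by norm_num)).1 h))
    · exact Or.inr (Or.inr ((Nat.prime_dvd_prime_iff_eq hp (by norm_num)).1 h))
  rcases h3 with rfl | rfl | rfl
  · rw [show 1023 / 3 = 341 from rfl, pow_341 α hα]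
    exact ph_ne_one α hα _ 237 (by decide +kernel)
  · rw [show 1023 / 11 = 93 from rfl, pow_93 α hα]
    exact ph_ne_one α hα _ 654 (by decide +kernel)
  · rw [show 1023 / 31 = 33 from rfl, ← ph_pow α hα, show it 33 1 = 620 by decide +kernel]
    exact ph_ne_one α hα _ 855 (by decide +kernel)
end ring

section field
variable {K : Type*} [Field K] [Fintype K] [CharP K 2]

theorem exists_root (hK : Fintype.card K = 1024) : ∃ α : K, α ^ 10 = α ^ 3 + 1 := by
  classical
  let L := AlgebraicClosure K
  have : CharP L 2 := charP_of_injective_algebraMap (algebraMap K L).injective 2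
  obtain ⟨β, hβ⟩ : ∃ β : L, β ^ 10 = β ^ 3 + 1 := by
    have hd : (Polynomial.X ^ 10 - Polynomial.X ^ 3 - 1 : Polynomial L).degree = 10 := by
      compute_degree!
    obtain ⟨β, h⟩ := IsAlgClosed.exists_root
      (Polynomial.X ^ 10 - Polynomial.X ^ 3 - 1 : Polynomial L) (by rw [hd]; norm_num)
    refine ⟨β, ?_⟩
    simp [Polynomial.IsRoot] at h
    linear_combination h
  have h1 : β ^ 1024 = β := by rw [pow_succ, pow_1023 β hβ, one_mul]
  have h2 := (Polynomial.splits_X_pow_nat_card_sub_X (K := K)).roots_map (algebraMap K L)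
  have h3 : β ∈ ((Polynomial.X ^ Nat.card K - Polynomial.X : Polynomial K).map
      (algebraMap K L)).roots := by
    rw [Nat.card_eq_fintype_card, hK]
    simp only [Polynomial.map_sub, Polynomial.map_pow, Polynomial.map_X]
    rw [Polynomial.mem_roots (FiniteField.X_pow_card_sub_X_ne_zero L (by norm_num))]
    simp [Polynomial.IsRoot, h1]
  rw [h2, Multiset.mem_map] at h3
  obtain ⟨a, -, ha⟩ := h3
  refine ⟨a, (algebraMap K L).injective ?_⟩
  simp [ha, hβ]

open Classical in
/-- number of cube roots -/
noncomputable def cr (u : K) : ℕ := (Finset.univ.filter fun x : K => x ^ 3 = u).card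

theorem cr_zero : cr (0 : K) = 1 := by
  classical
  unfold cr
  have : (Finset.univ.filter fun x : K => x ^ 3 = 0) = {0} := by ext x; simp
  convert Finset.card_singleton (0 : K)

theorem pow_card (hK : Fintype.card K = 1024) (u : K) (hu : u ≠ 0) : u ^ 1023 = 1 := by
  have := FiniteField.pow_card_sub_one_eq_one u hu
  rwa [hK] at this

theorem cr_no (hK : Fintype.card K = 1024) (u : K) (hu : u ≠ 0) (h : u ^ 341 ≠ 1) : cr u = 0 := by
  classical
  unfold cr
  rw [Finset.card_eq_zero, Finset.filter_eq_empty_iff]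
  rintro x - rfl
  apply h
  rw [← pow_mul]
  exact pow_card hK x (by rintro rfl; simp at hu)

variable (α : K)

theorem univ_eq [DecidableEq K] (hK : Fintype.card K = 1024) (hα : α ^ 10 = α ^ 3 + 1) :
    (Finset.univ : Finset K).erase 0 = (Finset.range 1023).image (fun k => α ^ k) := by
  symm
  apply Finset.eq_of_subset_of_card_le
  · intro x hx
    obtain ⟨k, -, rfl⟩ := Finset.mem_image.1 hx
    simp only [Finset.mem_erase, Finset.mem_univ, and_true]
    apply pow_ne_zero
    rintro rfl
    simp at hα
  · rw [Finset.card_erase_of_mem (Finset.mem_univ _), Finset.card_univ, hK,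
      Finset.card_image_of_injOn, Finset.card_range]
    intro a ha b hb h
    have := pow_injOn_Iio_orderOf (x := α)
    rw [order α hα] at this
    exact this (by simpa using ha) (by simpa using hb) h

theorem cr_yes (hK : Fintype.card K = 1024) (hα : α ^ 10 = α ^ 3 + 1) (u : K) (hu : u ≠ 0)
    (h : u ^ 341 = 1) : cr u = 3 := by
  classical
  have h1 : u ∈ (Finset.univ : Finset K).erase 0 := by simp [hu]
  rw [univ_eq α hK hα] at h1
  obtain ⟨k, -, rfl⟩ := Finset.mem_image.1 h1
  have h2 : (3 : ℕ) ∣ k := by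
    rw [← pow_mul] at h
    have := orderOf_dvd_of_pow_eq_one h
    rw [order α hα] at this
    omega
  obtain ⟨j, rfl⟩ := h2
  have hα0 : α ≠ 0 := by rintro rfl; simp at hα
  set c := α ^ j with hc
  have hc0 : c ≠ 0 := pow_ne_zero _ hα0
  have hcc : α ^ (3 * j) = c ^ 3 := by rw [hc, ← pow_mul, mul_comm]
  set w := α ^ 341 with hw
  have hw1 : w ≠ 1 := by
    intro h
    have := orderOf_dvd_of_pow_eq_one h
    rw [order α hα] at this
    omega
  have hw3 : w ^ 2 + w + 1 = 0 := by
    have : (w - 1) * (w ^ 2 + w + 1) = 0 := by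
      have : w ^ 3 = 1 := by rw [hw, ← pow_mul]; exact pow_1023 α hα
      linear_combination this
    exact (mul_eq_zero.1 this).resolve_left (sub_ne_zero.2 hw1)
  have hw0 : w ≠ 0 := pow_ne_zero _ hα0
  unfold cr
  have hs : (Finset.univ.filter fun x : K => x ^ 3 = α ^ (3 * j)) = {c, c * w, c * w ^ 2} := by
    ext x
    simp only [Finset.mem_filter, Finset.mem_univ, true_and, Finset.mem_insert,
      Finset.mem_singleton, hcc]
    have hf : x ^ 3 - c ^ 3 = (x - c) * ((x - c * w) * (x - c * w ^ 2)) := by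
      linear_combination (x ^ 2 * c - c ^ 2 * x * w + c ^ 3 * (w - 1)) * hw3
    rw [← sub_eq_zero, hf, mul_eq_zero, mul_eq_zero, sub_eq_zero, sub_eq_zero, sub_eq_zero]
  have h1 : c ≠ c * w := fun h => hw1 (mul_left_cancel₀ hc0 (by rw [← h, mul_one]))
  have h2 : c * w ≠ c * w ^ 2 := fun h => hw1 (by
    have := mul_left_cancel₀ hc0 h
    exact mul_left_cancel₀ hw0 (by rw [← pow_two, ← this, mul_one]))
  have h3 : c ≠ c * w ^ 2 := fun h => hw1 (by
    have h4 : 1 = w ^ 2 := mul_left_cancel₀ hc0 (by rw [← h, mul_one])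
    have h5 : w = 0 := by
      have := CharTwo.add_self_eq_zero (1 : K)
      linear_combination hw3 + h4 - this
    exact absurd h5 hw0)
  have : (({c, c * w, c * w ^ 2} : Finset K)).card = 3 :=
    Finset.card_eq_three.2 ⟨_, _, _, h1, h3, h2, rfl⟩
  rw [← hs] at this
  convert this

open Classical in
/-- number of affine points above `y` -/
noncomputable def fc (y : K) : ℕ :=
  (Finset.univ.filter fun x : K => x ^ 3 * y ^ 2 + y ^ 5 + x ^ 3 * y + y ^ 3 + 1 = 0).card

theorem fc_zero : fc (0 : K) = 0 := by simp [fc]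

theorem two_zero : (2 : K) = 0 := CharTwo.two_eq_zero

theorem fc_one : fc (1 : K) = 0 := by
  classical
  unfold fc
  rw [Finset.card_eq_zero, Finset.filter_eq_empty_iff]
  intro x _ h
  have : (1 : K) = 0 := by linear_combination h - (x ^ 3 + 1) * (two_zero (K := K))
  exact one_ne_zero this

theorem fc_eq (y : K) (hy : y ^ 2 + y ≠ 0) : fc y = cr ((y ^ 5 + y ^ 3 + 1) / (y ^ 2 + y)) := by
  unfold fc cr
  congr 1
  ext x
  simp only [Finset.mem_filter, Finset.mem_univ, true_and]
  rw [eq_div_iff hy]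
  constructor
  · intro h
    linear_combination h - (y ^ 5 + y ^ 3 + 1) * (two_zero (K := K))
  · intro h
    linear_combination h + (y ^ 5 + y ^ 3 + 1) * (two_zero (K := K))

theorem G_eq (v : ℕ) : G v = if v = 1 then 3 else if v = 0 then 1 else
    if v = 236 then 0 else if v = 237 then 0 else 5000 := by
  unfold G
  rw [force_eq]
  simp only [Bool.cond_eq_ite, Nat.beq_eq]

theorem G_fc [DecidableEq K] (hK : Fintype.card K = 1024) (hα : α ^ 10 = α ^ 3 + 1) (n : ℕ)
    (hn : ph α 10 n ≠ 0) (hG : G (val n) < 5000) :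
    fc (ph α 10 n) + (if ph α 10 n = 1 then 1 else 0) = G (val n) := by
  have hv := ph_val α hα n
  generalize ph α 10 n = y at *
  generalize val n = v at *
  rw [G_eq] at *
  by_cases hy : y = 1
  · subst hy
    have h0 : ph α 10 v = 0 := by
      rw [hv, one_pow 2, CharTwo.add_self_eq_zero (1 : K)]; simp
    rw [fc_one]
    have h1 : v ≠ 1 := by rintro rfl; rw [ph_one] at h0; exact one_ne_zero h0
    have h236 : v ≠ 236 := by
      rintro rfl
      have := ph_mul α hα 236 237
      rw [h0, show mul 236 237 = 1 by decide +kernel, ph_one] at this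
      simp at this
    have h237 : v ≠ 237 := by
      rintro rfl
      have := ph_mul α hα 236 237
      rw [h0, show mul 236 237 = 1 by decide +kernel, ph_one] at this
      simp at this
    by_cases hv0 : v = 0
    · subst hv0; simp
    · exfalso
      simp [h1, h236, h237, hv0] at hG
  rw [if_neg hy, add_zero]
  have hd : y ^ 2 + y ≠ 0 := by
    rw [show y ^ 2 + y = y * (y + 1) by ring]
    refine mul_ne_zero hn fun h => hy ?_
    linear_combination h - two_zero (K := K)
  rw [fc_eq y hd]
  set d := y ^ 2 + y
  set h := y ^ 5 + y ^ 3 + 1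
  have hu : (h / d) ^ 341 = ph α 10 v := by
    rw [hv, div_pow, div_eq_iff (pow_ne_zero _ hd), mul_pow, mul_assoc, ← pow_mul, ← pow_add,
      pow_card hK d hd, mul_one]
  by_cases h1 : v = 1
  · subst h1
    rw [ph_one] at hu
    rw [cr_yes α hK hα _ (by intro h; rw [h] at hu; simp at hu) hu]
    rfl
  by_cases h0 : v = 0
  · subst h0
    rw [ph_zero] at hu
    rw [pow_eq_zero_iff (by norm_num)] at hu
    rw [hu, cr_zero]
    rfl
  have hm := ph_mul α hα 236 237
  rw [show mul 236 237 = 1 by decide +kernel, ph_one] at hm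
  by_cases h2 : v = 236
  · subst h2
    rw [cr_no hK]
    · rfl
    · intro h0; rw [← hu, h0] at hm; simp at hm
    · rw [hu]; exact ph_ne_one α hα _ 236 (by decide +kernel)
  by_cases h3 : v = 237
  · subst h3
    rw [cr_no hK]
    · rfl
    · intro h0; rw [← hu, h0] at hm; simp at hm
    · rw [hu]; exact ph_ne_one α hα _ 237 (by decide +kernel)
  exfalso
  simp [h1, h0, h2, h3] at hG

theorem run_sum (n : ℕ) : ∀ y, run n y = ∑ k ∈ Finset.range n, G (val (it k y)) := by
  induction n with
  | zero => intro y; rfl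
  | succ n ih =>
    intro y
    rw [run_succ, ih, Finset.sum_range_succ', add_comm]
    simp only [it_succ]
    rfl

theorem sum_fc (hK : Fintype.card K = 1024) (hα : α ^ 10 = α ^ 3 + 1) :
    ∑ y : K, fc y = 1340 := by
  classical
  have hα0 : α ≠ 0 := by rintro rfl; simp at hα
  have hinj : Set.InjOn (fun k : ℕ => α ^ k) (Finset.range 1023 : Finset ℕ) := by
    intro a ha b hb h
    have := pow_injOn_Iio_orderOf (x := α)
    rw [order α hα] at this
    exact this (by simpa using ha) (by simpa using hb) h
  have hr := run_sum 1023 1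
  rw [run_eq] at hr
  have h1 : ∀ k ∈ Finset.range 1023, fc (α ^ k) + (if α ^ k = 1 then 1 else 0)
      = G (val (it k 1)) := by
    intro k hk
    have hle := Finset.single_le_sum (f := fun k => G (val (it k 1)))
      (fun _ _ => Nat.zero_le _) hk
    rw [← hr] at hle
    have := G_fc α hK hα (it k 1) (by rw [ph_pow α hα]; exact pow_ne_zero _ hα0)
      (lt_of_le_of_lt hle (by norm_num))
    rwa [ph_pow α hα] at this
  rw [← Finset.sum_congr rfl h1] at hr
  rw [← Finset.sum_image (f := fun y : K => fc y + if y = 1 then 1 else 0) hinj,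
    ← univ_eq α hK hα, Finset.sum_add_distrib] at hr
  rw [← Finset.add_sum_erase _ _ (Finset.mem_univ (0 : K)), fc_zero]
  simp at hr
  omega

theorem cr_one (hK : Fintype.card K = 1024) (hα : α ^ 10 = α ^ 3 + 1) : cr (1 : K) = 3 :=
  cr_yes α hK hα 1 one_ne_zero (one_pow _)

/-- value of the quintic -/
def qf (v : Fin 3 → K) : K :=
  v 0 ^ 3 * v 1 ^ 2 + v 1 ^ 5 + v 0 ^ 3 * v 1 * v 2 + v 1 ^ 3 * v 2 ^ 2 + v 2 ^ 5

/-- normalised representatives of the points other than `(1:0:0)` -/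
def nf : (K × K) ⊕ K → (Fin 3 → K)
  | Sum.inl (y, x) => ![x, y, 1]
  | Sum.inr x => ![x, 1, 0]

theorem nf_ne (b : (K × K) ⊕ K) : nf b ≠ 0 := by
  rcases b with ⟨y, x⟩ | x
  · intro h; have := congrFun h 2; simp [nf] at this
  · intro h; have := congrFun h 1; simp [nf] at this

theorem nf_inj (a b : (K × K) ⊕ K) (c : K) (h : c • nf a = nf b) : a = b := by
  have h0 := congrFun h 0
  have h1 := congrFun h 1
  have h2 := congrFun h 2
  rcases a with ⟨y, x⟩ | x <;> rcases b with ⟨y', x'⟩ | x' <;> simp [nf] at h0 h1 h2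
  · subst h2; simp at h0 h1; simp [h0, h1]
  · subst h2; simp at h1
  · subst h1; simp at h0; simp [h0]

open Classical in
/-- the curve in normalised coordinates -/
noncomputable def cs : Finset ((K × K) ⊕ K) := Finset.univ.filter fun b => qf (nf b) = 0

theorem cs_card (hK : Fintype.card K = 1024) : (cs (K := K)).card = 1343 := by
  classical
  obtain ⟨α, hα⟩ := exists_root hK
  have hs : (cs (K := K)) =
      (((Finset.univ : Finset K).sigma fun y => Finset.univ.filter fun x : K =>
        x ^ 3 * y ^ 2 + y ^ 5 + x ^ 3 * y + y ^ 3 + 1 = 0).map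
          (Equiv.sigmaEquivProd K K).toEmbedding).disjSum
      (Finset.univ.filter fun x : K => x ^ 3 = 1) := by
    ext b
    unfold cs
    rw [Finset.mem_filter]
    rcases b with ⟨y, x⟩ | x
    · simp [nf, qf]
    · simp only [nf, qf, Finset.mem_filter, Finset.mem_univ, true_and, Finset.inr_mem_disjSum]
      simp only [Matrix.cons_val]
      constructor
      · intro h; linear_combination h - two_zero (K := K)
      · intro h; linear_combination h + two_zero (K := K)
  rw [hs, Finset.card_disjSum, Finset.card_map, Finset.card_sigma]
  have h1 := sum_fc α hK hα
  have h2 := cr_one α hK hα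
  unfold fc at h1
  unfold cr at h2
  have h3 : ∀ a b : ℕ, a = 1340 → b = 3 → a + b = 1343 := by rintro a b rfl rfl; rfl
  apply h3
  · convert h1
  · convert h2

theorem proj_card (hK : Fintype.card K = 1024) :
    Nat.card {P : Projectivization K (Fin 3 → K) //
      qf P.rep = 0 ∧ (P.rep 1 ≠ 0 ∨ P.rep 2 ≠ 0)} = 1343 := by
  classical
  let F : (K × K) ⊕ K → Projectivization K (Fin 3 → K) := fun b => Projectivization.mk K (nf b) (nf_ne b)
  have hF : Function.Injective F := by
    intro a b h
    obtain ⟨c, hc⟩ := (Projectivization.mk_eq_mk_iff' K _ _ (nf_ne a) (nf_ne b)).1 h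
    exact (nf_inj b a c hc).symm
  have hq : ∀ (a : K) (v : Fin 3 → K), qf (a • v) = a ^ 5 * qf v := by
    intro a v; simp [qf]; ring
  have hset : {P : Projectivization K (Fin 3 → K) | qf P.rep = 0 ∧ (P.rep 1 ≠ 0 ∨ P.rep 2 ≠ 0)}
      = F '' (cs (K := K) : Set ((K × K) ⊕ K)) := by
    ext P
    simp only [Set.mem_ofPred_eq, Set.mem_image, Finset.mem_coe]
    constructor
    · rintro ⟨h, h'⟩
      have key : ∀ (c : K) (b : (K × K) ⊕ K), c ≠ 0 → c • nf b = P.rep →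
          ∃ x ∈ cs (K := K), F x = P := by
        intro c b hc hb
        refine ⟨b, ?_, ?_⟩
        · rw [← hb, hq] at h
          simpa [cs, hc] using h
        · rw [← P.mk_rep]
          symm
          exact (Projectivization.mk_eq_mk_iff' K _ _ _ (nf_ne b)).2 ⟨c, hb⟩
      by_cases h2 : P.rep 2 = 0
      · have h1 : P.rep 1 ≠ 0 := by simpa [h2] using h'
        refine key (P.rep 1) (Sum.inr (P.rep 0 / P.rep 1)) h1 ?_
        ext i
        fin_cases i <;> simp [nf, h2]
        field_simp
      · refine key (P.rep 2) (Sum.inl (P.rep 1 / P.rep 2, P.rep 0 / P.rep 2)) h2 ?_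
        ext i
        fin_cases i <;> simp [nf] <;> field_simp
    · rintro ⟨b, hb, rfl⟩
      obtain ⟨a, ha⟩ := Projectivization.exists_smul_eq_mk_rep K (nf b) (nf_ne b)
      have ha' : (F b).rep = (a : K) • nf b := ha.symm
      rw [ha', hq]
      refine ⟨?_, ?_⟩
      · have : qf (nf b) = 0 := by simpa [cs] using hb
        rw [this, mul_zero]
      · rcases b with ⟨y, x⟩ | x
        · right; simp [nf]
        · left; simp [nf]
  have h1 := Set.ncard_image_of_injective (cs (K := K) : Set ((K × K) ⊕ K)) hF
  rw [← hset, Set.ncard_coe_finset, cs_card hK] at h1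
  exact h1
end field
end Q

/-- The quintic has exactly `1343` smooth `F₁₀₂₄`-rational points, and
`(1:0:0)` is a singular point of the curve. -/
theorem stmt_11 :
    Nat.card {P : Projectivization (GaloisField 2 10) (Fin 3 → GaloisField 2 10) //
      eval P.rep quinticF1024 = 0 ∧
      ∃ i, eval P.rep (pderiv i quinticF1024) ≠ 0} = 1343 ∧
    (eval (![1, 0, 0] : Fin 3 → GaloisField 2 10) quinticF1024 = 0 ∧
     ∀ i, eval (![1, 0, 0] : Fin 3 → GaloisField 2 10) (pderiv i quinticF1024) = 0) := by
  have two : (2 : GaloisField 2 10) = 0 := CharTwo.two_eq_zero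
  have he : ∀ v : Fin 3 → GaloisField 2 10, eval v quinticF1024 = Q.qf v := by
    intro v; simp [quinticF1024, Q.qf]
  have d0 : ∀ v : Fin 3 → GaloisField 2 10, eval v (pderiv 0 quinticF1024)
      = v 0 ^ 2 * v 1 * (v 1 + v 2) := by
    intro v
    simp [quinticF1024, pderiv_X]
    linear_combination (v 0 ^ 2 * v 1 * (v 1 + v 2)) * two
  have d1 : ∀ v : Fin 3 → GaloisField 2 10, eval v (pderiv 1 quinticF1024)
      = v 1 ^ 4 + v 0 ^ 3 * v 2 + v 1 ^ 2 * v 2 ^ 2 := by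
    intro v
    simp [quinticF1024, pderiv_X]
    linear_combination (v 0 ^ 3 * v 1 + 2 * v 1 ^ 4 + v 1 ^ 2 * v 2 ^ 2) * two
  have d2 : ∀ v : Fin 3 → GaloisField 2 10, eval v (pderiv 2 quinticF1024)
      = v 0 ^ 3 * v 1 + v 2 ^ 4 := by
    intro v
    simp [quinticF1024, pderiv_X]
    linear_combination (v 1 ^ 3 * v 2 + 2 * v 2 ^ 4) * two
  refine ⟨?_, ?_, ?_⟩
  · let _ : Fintype (GaloisField 2 10) := Fintype.ofFinite _
    have hK : Fintype.card (GaloisField 2 10) = 1024 := by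
      rw [← Nat.card_eq_fintype_card, GaloisField.card 2 10 (by norm_num)]; norm_num
    rw [← Q.proj_card hK]
    apply Nat.card_congr
    apply Equiv.subtypeEquivRight
    intro P
    rw [he]
    apply and_congr_right
    intro h
    generalize P.rep = v at h
    constructor
    · intro h'
      by_contra hc
      push Not at hc
      obtain ⟨h1, h2⟩ := hc
      obtain ⟨i, hi⟩ := h'
      fin_cases i <;> simp [d0, d1, d2, h1, h2] at hi
    · intro h'
      by_contra hc
      push Not at hc
      have e0 := hc 0
      have e1 := hc 1
      have e2 := hc 2
      rw [d0] at e0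
      rw [d1] at e1
      rw [d2] at e2
      unfold Q.qf at h
      generalize v 0 = x at *
      generalize v 1 = y at *
      generalize v 2 = z at *
      have hy : y = 0 → False := by
        rintro rfl
        simp at e2 h'
        exact h' e2
      have hyz : y + z = 0 → False := by
        intro hyz
        have hz : z = y := by linear_combination hyz - y * two
        subst hz
        apply hy
        have : z ^ 5 = 0 := by linear_combination h - (x ^ 3 * z ^ 2 + z ^ 5) * two
        exact pow_eq_zero_iff (by norm_num) |>.1 this
      have hx : x = 0 := by
        rcases mul_eq_zero.1 e0 with h1 | h1
        · rcases mul_eq_zero.1 h1 with h2 | h2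
          · exact pow_eq_zero_iff (by norm_num) |>.1 h2
          · exact (hy h2).elim
        · exact (hyz h1).elim
      subst hx
      have hz : z = 0 := by simpa using e2
      subst hz
      apply hy
      simpa using e1
  · rw [he]; simp [Q.qf]
  · intro i
    fin_cases i
    · simp [d0]
    · simp [d1]
    · simp [d2]
end

section
/- The curve defined over F₂ by x⁵ + xy⁴ + y⁵ + (x²y² + y⁴)z + (x²y + xy²)z² + xz⁴ + z⁵ = 0 has exactly 350 smooth F₂₅₆-rational points. -/
open MvPolynomial

/-- The quintic `x⁵ + xy⁴ + y⁵ + (x²y² + y⁴)z + (x²y + xy²)z² + xz⁴ + z⁵`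
over `F₂₅₆`. -/
noncomputable def quinticF256 : MvPolynomial (Fin 3) (GaloisField 2 8) :=
  X 0 ^ 5 + X 0 * X 1 ^ 4 + X 1 ^ 5 +
    (X 0 ^ 2 * X 1 ^ 2 + X 1 ^ 4) * X 2 +
    (X 0 ^ 2 * X 1 + X 0 * X 1 ^ 2) * X 2 ^ 2 +
    X 0 * X 2 ^ 4 + X 2 ^ 5

/-! ### A computational model of `F₂₅₆`: bytes, with arithmetic modulo `X⁸ + X⁴ + X³ + X² + 1` -/

namespace QuinticAux

/-- Application of `f` to `n`, written so that kernel reduction evaluates `n` first. -/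
def force {α : Type} (n : ℕ) (f : ℕ → α) : α :=
  Nat.rec (f 0) (fun k _ => f (Nat.succ k)) n

theorem force_eq {α : Type} (n : ℕ) (f : ℕ → α) : force n f = f n := by
  cases n <;> rfl

/-- Multiplication of a byte by the class of `X`. -/
def mulx (a : ℕ) : ℕ := Nat.xor (Nat.mul 2 a) (Nat.mul 285 (Nat.div a 128))

theorem mulx_def (a : ℕ) (ha : a < 256) :
    mulx a = if a < 128 then 2 * a else (2 * a) ^^^ 285 := by
  change (2 * a) ^^^ (285 * (a / 128)) = _
  split
  · rw [Nat.div_eq_of_lt (by assumption)]; simp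
  · rw [show a / 128 = 1 by omega]

/-- Multiplication of `a` by the lowest `k` bits of `b` (Horner scheme). -/
def mulk : ℕ → ℕ → ℕ → ℕ
  | 0, _, _ => 0
  | k + 1, a, b => Nat.xor (Nat.mul (Nat.mod b 2) a) (force (mulk k a (Nat.div b 2)) mulx)

theorem mulk_succ (k a b : ℕ) :
    mulk (k + 1) a b = (if b % 2 = 1 then a else 0) ^^^ mulx (mulk k a (b / 2)) := by
  change (b % 2 * a) ^^^ force (mulk k a (b / 2)) mulx = _
  rw [force_eq]
  rcases Nat.mod_two_eq_zero_or_one b with hb | hb <;> simp [hb]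

/-- Multiplication of bytes. -/
def mul (a b : ℕ) : ℕ := force a fun a => force b fun b => mulk 8 a b

theorem mul_def (a b : ℕ) : mul a b = mulk 8 a b := by
  rw [mul, force_eq, force_eq]

/-- Interpretation of the lowest `k` bits of a number as a polynomial in `r`. -/
def phi {R : Type*} [CommRing R] (r : R) : ℕ → ℕ → R
  | 0, _ => 0
  | k + 1, n => ((n % 2 : ℕ) : R) + r * phi r k (n / 2)

section ring
variable {R : Type*} [CommRing R] (r : R)

theorem phi_zero (k : ℕ) : phi r k 0 = 0 := by
  induction k with
  | zero => rfl
  | succ k ih => simp [phi, ih]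

theorem phi_xor (h2 : (2 : R) = 0) (k : ℕ) : ∀ a b : ℕ, phi r k (a ^^^ b) = phi r k a + phi r k b := by
  induction k with
  | zero => intro a b; simp [phi]
  | succ k ih =>
    intro a b
    have h : (((a ^^^ b) % 2 : ℕ) : R) = ((a % 2 : ℕ) : R) + ((b % 2 : ℕ) : R) := by
      rw [Nat.xor_mod_two_eq]
      rcases Nat.mod_two_eq_zero_or_one a with ha | ha <;>
      rcases Nat.mod_two_eq_zero_or_one b with hb | hb <;>
      simp [Nat.add_mod, ha, hb]
      rw [one_add_one_eq_two, h2]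
    simp only [phi, Nat.xor_div_two, ih, h]
    ring

theorem phi_succ (k : ℕ) : ∀ a : ℕ, a < 2 ^ k → phi r (k + 1) a = phi r k a := by
  induction k with
  | zero => intro a ha; simp at ha; simp [phi, ha]
  | succ k ih =>
    intro a ha
    rw [phi, ih (a / 2) (by rw [pow_succ] at ha; omega)]
    rfl

theorem phi_double (k a : ℕ) : phi r (k + 1) (2 * a) = r * phi r k a := by
  simp [phi]

theorem mulx_lt (a : ℕ) (ha : a < 256) : mulx a < 256 := by
  revert a; decide +kernel

theorem mulk_lt (k a b : ℕ) (ha : a < 256) : mulk k a b < 256 := by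
  induction k generalizing b with
  | zero => simp [mulk]
  | succ k ih =>
    rw [mulk_succ]
    refine Nat.xor_lt_two_pow (n := 8) ?_ (mulx_lt _ (ih _))
    split <;> omega

theorem mul_lt (a b : ℕ) (ha : a < 256) : mul a b < 256 := by
  rw [mul_def]; exact mulk_lt 8 a b ha

theorem phi_mulx (h2 : (2 : R) = 0) (hr : r ^ 8 + r ^ 4 + r ^ 3 + r ^ 2 + 1 = 0) (a : ℕ)
    (ha : a < 256) : phi r 8 (mulx a) = r * phi r 8 a := by
  rw [← phi_succ r 8 _ (mulx_lt a ha), ← phi_double]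
  rw [mulx_def a ha]
  split
  · rfl
  · rw [phi_xor r h2]
    have : phi r 9 285 = 0 := by
      simp [phi]
      linear_combination hr
    rw [this, add_zero]

theorem phi_mulk (h2 : (2 : R) = 0) (hr : r ^ 8 + r ^ 4 + r ^ 3 + r ^ 2 + 1 = 0) (k a b : ℕ)
    (ha : a < 256) : phi r 8 (mulk k a b) = phi r 8 a * phi r k b := by
  induction k generalizing b with
  | zero => simp [mulk, phi]
  | succ k ih =>
    have hp : phi r (k + 1) b = ((b % 2 : ℕ) : R) + r * phi r k (b / 2) := rfl
    rw [mulk_succ, phi_xor r h2, phi_mulx r h2 hr _ (mulk_lt k a _ ha), ih, hp]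
    rcases Nat.mod_two_eq_zero_or_one b with hb | hb
    · rw [hb, if_neg (by decide), phi_zero]; push_cast; ring
    · rw [hb, if_pos rfl]; push_cast; ring

theorem phi_mul (h2 : (2 : R) = 0) (hr : r ^ 8 + r ^ 4 + r ^ 3 + r ^ 2 + 1 = 0) (a b : ℕ)
    (ha : a < 256) : phi r 8 (mul a b) = phi r 8 a * phi r 8 b := by
  rw [mul_def]; exact phi_mulk r h2 hr 8 a b ha

/-- Squaring. -/
def sq (a : ℕ) : ℕ := force a fun a => mul a a

theorem sq_def (a : ℕ) : sq a = mul a a := force_eq _ _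

theorem sq_lt (a : ℕ) (ha : a < 256) : sq a < 256 := by
  rw [sq_def]; exact mul_lt a a ha

theorem phi_sq (h2 : (2 : R) = 0) (hr : r ^ 8 + r ^ 4 + r ^ 3 + r ^ 2 + 1 = 0) (a : ℕ)
    (ha : a < 256) : phi r 8 (sq a) = phi r 8 a ^ 2 := by
  rw [sq_def, phi_mul r h2 hr a a ha, pow_two]

theorem root_pow (h2 : (2 : R) = 0) (hr : r ^ 8 + r ^ 4 + r ^ 3 + r ^ 2 + 1 = 0) :
    r ^ 256 = r := by
  have key : ∀ k : ℕ, sq^[k] 2 < 256 ∧ phi r 8 (sq^[k] 2) = r ^ (2 ^ k) := by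
    intro k
    induction k with
    | zero => simp [phi]
    | succ k ih =>
      rw [Function.iterate_succ_apply']
      refine ⟨sq_lt _ ih.1, ?_⟩
      rw [phi_sq r h2 hr _ ih.1, ih.2, ← pow_mul, pow_succ]
  have h8 : sq^[8] 2 = 2 := by decide +kernel
  have := (key 8).2
  rw [h8] at this
  norm_num at this
  rw [← this]
  simp [phi]

end ring

/-- The inverse of a byte, with the fuel `k`: the product of `a ^ (2 ^ i)` for `1 ≤ i ≤ k`. -/
def invk : ℕ → ℕ → ℕ
  | 0, _ => 1
  | k + 1, a => force (sq a) fun b => mul b (invk k b)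

theorem mul_inv (a : ℕ) (ha : a < 256) (h0 : a ≠ 0) : mul a (invk 7 a) = 1 := by
  revert a; decide +kernel

theorem phi_ne_zero {K : Type*} [Field K] (r : K) (h2 : (2 : K) = 0)
    (hr : r ^ 8 + r ^ 4 + r ^ 3 + r ^ 2 + 1 = 0) (a : ℕ) (ha : a < 256) (h0 : a ≠ 0) :
    phi r 8 a ≠ 0 := by
  intro h
  have := phi_mul r h2 hr a (invk 7 a) ha
  rw [mul_inv a ha h0, h] at this
  simp [phi] at this

theorem phi_inj {K : Type*} [Field K] (r : K) (h2 : (2 : K) = 0)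
    (hr : r ^ 8 + r ^ 4 + r ^ 3 + r ^ 2 + 1 = 0) (a b : ℕ) (ha : a < 256) (hb : b < 256) :
    phi r 8 a = phi r 8 b ↔ a = b := by
  refine ⟨fun h => ?_, fun h => by rw [h]⟩
  by_contra hne
  refine phi_ne_zero r h2 hr (a ^^^ b) (Nat.xor_lt_two_pow (n := 8) ha hb)
    (by simpa [Nat.xor_eq_zero_iff] using hne) ?_
  rw [phi_xor r h2, h, ← two_mul, h2, zero_mul]

/-- A field with 256 elements contains a root of `X⁸ + X⁴ + X³ + X² + 1`. -/
theorem exists_root (K : Type*) [Field K] [Fintype K] [CharP K 2] (hK : Fintype.card K = 256) :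
    ∃ r : K, r ^ 8 + r ^ 4 + r ^ 3 + r ^ 2 + 1 = 0 := by
  classical
  let p : Polynomial K := Polynomial.X ^ 8 + Polynomial.X ^ 4 + Polynomial.X ^ 3 +
    Polynomial.X ^ 2 + 1
  have hdeg : p.degree = 8 := by
    simp only [p]; compute_degree!
  have h2 : (2 : AdjoinRoot p) = 0 := by
    have : (2 : K) = 0 := CharTwo.two_eq_zero
    have h := congrArg (AdjoinRoot.of p) this
    rwa [map_ofNat, map_zero] at h
  have hr : (AdjoinRoot.root p) ^ 8 + (AdjoinRoot.root p) ^ 4 + (AdjoinRoot.root p) ^ 3 +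
      (AdjoinRoot.root p) ^ 2 + 1 = 0 := by
    have h : AdjoinRoot.mk p p = 0 := AdjoinRoot.mk_self
    have h' : AdjoinRoot.mk p (Polynomial.X ^ 8 + Polynomial.X ^ 4 + Polynomial.X ^ 3 +
      Polynomial.X ^ 2 + 1) = 0 := h
    simpa only [map_add, map_pow, map_one, AdjoinRoot.mk_X] using h'
  have hdvd : p ∣ Polynomial.X ^ 256 - Polynomial.X := by
    rw [← AdjoinRoot.mk_eq_zero]
    simp [root_pow _ h2 hr]
  have hsplit : (Polynomial.X ^ 256 - Polynomial.X : Polynomial K).Splits := by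
    have h := FiniteField.roots_X_pow_card_sub_X K
    rw [hK] at h
    rw [Polynomial.splits_iff_card_roots, h,
      FiniteField.X_pow_card_sub_X_natDegree_eq K (by norm_num)]
    simpa using hK
  have hps := hsplit.of_dvd (FiniteField.X_pow_card_sub_X_ne_zero K (by norm_num)) hdvd
  obtain ⟨a, ha⟩ := hps.exists_eval_eq_zero (by rw [hdeg]; norm_num)
  exact ⟨a, by simpa [p] using ha⟩

/-- The table of fifth powers, one byte per element. -/
def tab : ℕ := 13029815358466344702779717225034713290305719147351420262606760775753458642938018908042876582423337092026137038453587933772031512643833990458311355407998993022043168953485169310592363236775218109156937169738632637706834687434662534200844811503245325343194110119311596218806488300040722991453757415902181867267843215065595286036441620668456021686392098502089212962848771038168522255234885525352670173867238652397560951240570435516174644929586626502522678140886534143254974268271751308186110494788881469479341542998375112266130626720913985514313025426161712829289310595008105257890454190801419976863694213031473713250560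

/-- Fifth power by table lookup. -/
def t5 (y : ℕ) : ℕ := (tab >>> (8 * y)) % 256

theorem t5_eq (y : ℕ) (hy : y < 256) : t5 y = mul y (sq (sq y)) := by
  revert y; decide +kernel

/-- The linear function on bit vectors with the given values on the basis (highest bit first). -/
def lin : List ℕ → ℕ → ℕ
  | [], _ => 0
  | l :: ls, t => (if (t / 2 ^ ls.length) % 2 = 1 then l else 0) ^^^ lin ls t

/-- Tree search for the solutions of `acc + lin ls t = (2 ^ length * y + t) ^ 5`. -/
def go (ls : List ℕ) : ℕ → ℕ → ℕ :=
  List.rec (fun acc y => bif Nat.beq acc (t5 y) then 1 else 0)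
    (fun l _ ih acc y => force (Nat.mul 2 y) fun z =>
      Nat.add (ih acc z) (force (Nat.xor acc l) fun a => ih a (Nat.succ z))) ls

theorem go_cons (l : ℕ) (ls : List ℕ) (acc y : ℕ) :
    go (l :: ls) acc y = go ls acc (2 * y) + go ls (acc ^^^ l) (2 * y + 1) := by
  change (force (2 * y) fun z => go ls acc z + (force (acc ^^^ l) fun a => go ls a (z + 1))) = _
  rw [force_eq, force_eq]

theorem lin_mod (ls : List ℕ) (t s : ℕ) (n : ℕ) (hn : ls.length ≤ n) :
    lin ls (2 ^ n * s + t) = lin ls t := by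
  induction ls with
  | nil => rfl
  | cons l ls ih =>
    simp only [List.length_cons] at hn
    rw [lin, lin, ih (by omega)]
    obtain ⟨m, rfl⟩ := Nat.exists_eq_add_of_le hn
    have : (2 ^ (ls.length + 1 + m) * s + t) / 2 ^ ls.length
        = 2 * (2 ^ m * s) + t / 2 ^ ls.length := by
      rw [show 2 ^ (ls.length + 1 + m) * s + t = t + 2 ^ ls.length * (2 * (2 ^ m * s)) by ring,
        Nat.add_mul_div_left _ _ (by positivity), add_comm]
    rw [this, Nat.mul_add_mod]

theorem go_eq (ls : List ℕ) (acc y : ℕ) :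
    go ls acc y = Nat.count (fun t => acc ^^^ lin ls t = t5 (2 ^ ls.length * y + t))
      (2 ^ ls.length) := by
  induction ls generalizing acc y with
  | nil =>
    change (bif Nat.beq acc (t5 y) then 1 else 0) = _
    by_cases h : acc = t5 y
    · have hb : Nat.beq acc (t5 y) = true := Nat.beq_eq ▸ h
      simp only [lin, List.length_nil, pow_zero, hb]
      rw [Nat.count_eq_card_filter_range, Finset.card_filter, Finset.sum_range_one]
      simp [← h]
    · have hb : Nat.beq acc (t5 y) = false := by
        rw [← Bool.not_eq_true, Nat.beq_eq]; exact h
      simp only [lin, List.length_nil, pow_zero, hb]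
      rw [Nat.count_eq_card_filter_range, Finset.card_filter, Finset.sum_range_one]
      simp [h]
  | cons l ls ih =>
    rw [go_cons, ih, ih, List.length_cons, pow_succ, mul_two, Nat.count_add]
    congr 1
    · rw [Nat.count_eq_card_filter_range, Nat.count_eq_card_filter_range]
      congr 1
      apply Finset.filter_congr
      intro t ht
      rw [Finset.mem_range] at ht
      rw [lin, Nat.div_eq_of_lt ht]
      simp
      ring_nf
    · rw [Nat.count_eq_card_filter_range, Nat.count_eq_card_filter_range]
      congr 1
      apply Finset.filter_congr
      intro t ht
      rw [Finset.mem_range] at ht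
      have h1 : (2 ^ ls.length + t) / 2 ^ ls.length = 1 := by
        rw [Nat.add_div_left _ (by positivity), Nat.div_eq_of_lt ht]
      have h2 := lin_mod ls t 1 ls.length le_rfl
      rw [mul_one] at h2
      rw [lin, h1, h2]
      simp [Nat.xor_assoc]
      ring_nf

/-- The value at `2 ^ i` of the linear part in `y` of the quintic. -/
def lval (x i : ℕ) : ℕ :=
  mul (x ^^^ 1) (sq (sq (2 ^ i))) ^^^ mul (sq x ^^^ x) (sq (2 ^ i)) ^^^ mul (sq x) (2 ^ i)

/-- The values of the linear part on the basis. -/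
def lvals (x : ℕ) : List ℕ :=
  [lval x 7, lval x 6, lval x 5, lval x 4, lval x 3, lval x 2, lval x 1, lval x 0]

/-- The constant coefficient in `y`. -/
def cval (x : ℕ) : ℕ := t5 x ^^^ x ^^^ 1

/-- The number of affine points with the given first coordinate. -/
def row (x : ℕ) : ℕ :=
  force (lval x 7) fun a7 => force (lval x 6) fun a6 => force (lval x 5) fun a5 =>
  force (lval x 4) fun a4 => force (lval x 3) fun a3 => force (lval x 2) fun a2 =>
  force (lval x 1) fun a1 => force (lval x 0) fun a0 => force (cval x) fun c =>
    go [a7, a6, a5, a4, a3, a2, a1, a0] c 0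

theorem row_def (x : ℕ) : row x = go (lvals x) (cval x) 0 := by
  simp only [row, force_eq, lvals]

/-- The number of affine points. -/
def total : ℕ → ℕ
  | 0 => 0
  | k + 1 => Nat.add (total k) (row k)

theorem total_eq : total 256 = 348 := by decide +kernel

theorem inf_eq : (Finset.filter (fun x : Fin 256 => cval x = 0) Finset.univ).card = 2 := by
  decide +kernel

/-! ### Counting points in a field with 256 elements -/

section count
variable {K : Type*} [Field K]

/-- The quintic as a function. -/
def F (x y z : K) : K :=
  x ^ 5 + x * y ^ 4 + y ^ 5 + (x ^ 2 * y ^ 2 + y ^ 4) * z + (x ^ 2 * y + x * y ^ 2) * z ^ 2 +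
    x * z ^ 4 + z ^ 5

theorem phi_pow (r : K) (i : ℕ) (hi : i < 8) : phi r 8 (2 ^ i) = r ^ i := by
  interval_cases i <;> simp [phi] <;> ring

theorem phi_one (r : K) : phi r 8 1 = 1 := by simp [phi]

theorem phi_ite (r : K) (b l : ℕ) :
    phi r 8 (if b % 2 = 1 then l else 0) = ((b % 2 : ℕ) : K) * phi r 8 l := by
  rcases Nat.mod_two_eq_zero_or_one b with hb | hb <;> simp [hb, phi_zero]

theorem two_pow_lt {i : ℕ} (hi : i < 8) : 2 ^ i < 256 :=
  (Nat.pow_lt_pow_iff_right (by norm_num : 1 < 2)).2 hi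

theorem lval_lt (x i : ℕ) (hx : x < 256) : lval x i < 256 := by
  have h1 : x ^^^ 1 < 256 := Nat.xor_lt_two_pow (n := 8) hx (by norm_num)
  have h2 : sq x ^^^ x < 256 := Nat.xor_lt_two_pow (n := 8) (sq_lt x hx) hx
  exact Nat.xor_lt_two_pow (n := 8) (Nat.xor_lt_two_pow (n := 8) (mul_lt _ _ h1) (mul_lt _ _ h2))
    (mul_lt _ _ (sq_lt x hx))

theorem lin_lt (ls : List ℕ) (t : ℕ) (h : ∀ l ∈ ls, l < 256) : lin ls t < 256 := by
  induction ls with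
  | nil => simp [lin]
  | cons l ls ih =>
    refine Nat.xor_lt_two_pow (n := 8) ?_ (ih fun a ha => h a (List.mem_cons_of_mem _ ha))
    have := h l List.mem_cons_self
    split <;> omega

theorem lvals_lt (x t : ℕ) (hx : x < 256) : lin (lvals x) t < 256 := by
  apply lin_lt
  intro l hl
  simp only [lvals, List.mem_cons, List.not_mem_nil, or_false] at hl
  rcases hl with h | h | h | h | h | h | h | h <;> rw [h] <;> exact lval_lt x _ hx

theorem t5_lt (y : ℕ) : t5 y < 256 := Nat.mod_lt _ (by norm_num)

theorem cval_lt (x : ℕ) (hx : x < 256) : cval x < 256 :=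
  Nat.xor_lt_two_pow (n := 8) (Nat.xor_lt_two_pow (n := 8) (t5_lt x) hx) (by norm_num)

theorem phi_lval [CharP K 2] (r : K)
    (hr : r ^ 8 + r ^ 4 + r ^ 3 + r ^ 2 + 1 = 0) (x i : ℕ) (hx : x < 256) (hi : i < 8) :
    phi r 8 (lval x i) = (phi r 8 x + 1) * ((r ^ i) ^ 2) ^ 2 +
      (phi r 8 x ^ 2 + phi r 8 x) * (r ^ i) ^ 2 + phi r 8 x ^ 2 * r ^ i := by
  have h2 : (2 : K) = 0 := CharTwo.two_eq_zero
  have hi' := two_pow_lt hi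
  have h1 : x ^^^ 1 < 256 := Nat.xor_lt_two_pow (n := 8) hx (by norm_num)
  have h3 : sq x ^^^ x < 256 := Nat.xor_lt_two_pow (n := 8) (sq_lt x hx) hx
  rw [lval, phi_xor r h2, phi_xor r h2, phi_mul r h2 hr _ _ h1, phi_mul r h2 hr _ _ h3,
    phi_mul r h2 hr _ _ (sq_lt x hx), phi_xor r h2, phi_xor r h2, phi_sq r h2 hr _ (sq_lt _ hi'),
    phi_sq r h2 hr _ hi', phi_sq r h2 hr _ hx, phi_pow r i hi, phi_one r]

theorem phi_lin [CharP K 2] (r : K)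
    (hr : r ^ 8 + r ^ 4 + r ^ 3 + r ^ 2 + 1 = 0) (x t : ℕ) (hx : x < 256) :
    phi r 8 (lin (lvals x) t) = (phi r 8 x + 1) * (phi r 8 t ^ 2) ^ 2 +
      (phi r 8 x ^ 2 + phi r 8 x) * phi r 8 t ^ 2 + phi r 8 x ^ 2 * phi r 8 t := by
  have h2 : (2 : K) = 0 := CharTwo.two_eq_zero
  have hb : ∀ n : ℕ, ((n % 2 : ℕ) : K) ^ 2 = ((n % 2 : ℕ) : K) := by
    intro n
    rcases Nat.mod_two_eq_zero_or_one n with hb | hb <;> simp [hb]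
  have ht : phi r 8 t = ((t / 2 ^ 7 % 2 : ℕ) : K) * r ^ 7 + ((t / 2 ^ 6 % 2 : ℕ) : K) * r ^ 6 +
      ((t / 2 ^ 5 % 2 : ℕ) : K) * r ^ 5 + ((t / 2 ^ 4 % 2 : ℕ) : K) * r ^ 4 +
      ((t / 2 ^ 3 % 2 : ℕ) : K) * r ^ 3 + ((t / 2 ^ 2 % 2 : ℕ) : K) * r ^ 2 +
      ((t / 2 ^ 1 % 2 : ℕ) : K) * r ^ 1 + ((t / 2 ^ 0 % 2 : ℕ) : K) * r ^ 0 := by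
    simp only [phi, Nat.div_div_eq_div_mul]
    norm_num
    ring
  have hl : phi r 8 (lin (lvals x) t) = ((t / 2 ^ 7 % 2 : ℕ) : K) * phi r 8 (lval x 7) +
      ((t / 2 ^ 6 % 2 : ℕ) : K) * phi r 8 (lval x 6) +
      ((t / 2 ^ 5 % 2 : ℕ) : K) * phi r 8 (lval x 5) +
      ((t / 2 ^ 4 % 2 : ℕ) : K) * phi r 8 (lval x 4) +
      ((t / 2 ^ 3 % 2 : ℕ) : K) * phi r 8 (lval x 3) +
      ((t / 2 ^ 2 % 2 : ℕ) : K) * phi r 8 (lval x 2) +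
      ((t / 2 ^ 1 % 2 : ℕ) : K) * phi r 8 (lval x 1) +
      ((t / 2 ^ 0 % 2 : ℕ) : K) * phi r 8 (lval x 0) := by
    simp only [lvals, lin, phi_xor r h2, phi_ite, List.length_cons, List.length_nil, phi_zero]
    ring
  rw [hl, ht]
  simp only [CharTwo.add_sq, mul_pow, hb]
  rw [phi_lval r hr x 7 hx (by norm_num), phi_lval r hr x 6 hx (by norm_num),
    phi_lval r hr x 5 hx (by norm_num), phi_lval r hr x 4 hx (by norm_num),
    phi_lval r hr x 3 hx (by norm_num), phi_lval r hr x 2 hx (by norm_num),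
    phi_lval r hr x 1 hx (by norm_num), phi_lval r hr x 0 hx (by norm_num)]
  generalize phi r 8 x = u
  ring

theorem phi_t5 [CharP K 2] (r : K)
    (hr : r ^ 8 + r ^ 4 + r ^ 3 + r ^ 2 + 1 = 0) (y : ℕ) (hy : y < 256) : phi r 8 (t5 y) = phi r 8 y ^ 5 := by
  have h2 : (2 : K) = 0 := CharTwo.two_eq_zero
  rw [t5_eq y hy, phi_mul r h2 hr _ _ hy, phi_sq r h2 hr _ (sq_lt y hy), phi_sq r h2 hr _ hy]
  generalize phi r 8 y = u
  ring

theorem phi_cval [CharP K 2] (r : K)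
    (hr : r ^ 8 + r ^ 4 + r ^ 3 + r ^ 2 + 1 = 0) (x : ℕ) (hx : x < 256) :
    phi r 8 (cval x) = phi r 8 x ^ 5 + phi r 8 x + 1 := by
  have h2 : (2 : K) = 0 := CharTwo.two_eq_zero
  rw [cval, phi_xor r h2, phi_xor r h2, phi_t5 r hr x hx, phi_one r]

theorem F_affine [CharP K 2] (r : K)
    (hr : r ^ 8 + r ^ 4 + r ^ 3 + r ^ 2 + 1 = 0) (x y : ℕ) (hx : x < 256) (hy : y < 256) :
    F (phi r 8 x) (phi r 8 y) 1 = 0 ↔ cval x ^^^ lin (lvals x) y = t5 y := by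
  have h2 : (2 : K) = 0 := CharTwo.two_eq_zero
  rw [← phi_inj r h2 hr _ _ (Nat.xor_lt_two_pow (n := 8) (cval_lt x hx) (lvals_lt x y hx))
    (t5_lt y), phi_xor r h2, phi_cval r hr x hx, phi_lin r hr x y hx, phi_t5 r hr y hy,
    ← CharTwo.add_eq_zero (R := K) (a := _ + _), F]
  generalize phi r 8 x = u
  generalize phi r 8 y = v
  ring_nf

theorem F_inf [CharP K 2] (r : K)
    (hr : r ^ 8 + r ^ 4 + r ^ 3 + r ^ 2 + 1 = 0) (x : ℕ) (hx : x < 256) : F (phi r 8 x) 1 0 = 0 ↔ cval x = 0 := by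
  have h2 : (2 : K) = 0 := CharTwo.two_eq_zero
  rw [← phi_inj r h2 hr _ _ (cval_lt x hx) (by norm_num), phi_cval r hr x hx, phi_zero, F]
  generalize phi r 8 x = u
  ring_nf

end count

theorem total_sum (n : ℕ) : total n = ∑ x ∈ Finset.range n, go (lvals x) (cval x) 0 := by
  induction n with
  | zero => rfl
  | succ n ih => rw [Finset.sum_range_succ, ← ih, ← row_def]; rfl

theorem row_eq (x : ℕ) : go (lvals x) (cval x) 0 =
    Nat.card {y : Fin 256 // cval x ^^^ lin (lvals x) y = t5 y} := by
  rw [go_eq, show (lvals x).length = 8 from rfl, Nat.count_eq_card_filter_range,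
    Nat.card_eq_fintype_card, Fintype.card_subtype, Finset.card_filter, Finset.card_filter,
    Finset.sum_range]
  simp

theorem pair_card :
    Nat.card {p : Fin 256 × Fin 256 // cval p.1 ^^^ lin (lvals p.1) p.2 = t5 p.2} = 348 := by
  rw [← total_eq, total_sum, Finset.sum_range]
  simp_rw [row_eq]
  rw [← Nat.card_sigma]
  exact Nat.card_congr
    { toFun := fun p => ⟨p.1.1, p.1.2, p.2⟩
      invFun := fun p => ⟨(p.1, p.2.1), p.2.2⟩
      left_inv := fun p => rfl
      right_inv := fun p => rfl }

section field

theorem exists_equiv (K : Type*) [Field K] [Fintype K] [CharP K 2]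
    (hK : Fintype.card K = 256) : ∃ e : Fin 256 ≃ K,
    (∀ x y : Fin 256, F (e x) (e y) 1 = 0 ↔ cval x ^^^ lin (lvals x) y = t5 y) ∧
    (∀ x : Fin 256, F (e x) 1 0 = 0 ↔ cval x = 0) := by
  obtain ⟨r, hr⟩ := exists_root K hK
  have hbij : Function.Bijective (fun n : Fin 256 => phi r 8 n) := by
    rw [Fintype.bijective_iff_injective_and_card]
    refine ⟨fun a b h => ?_, by simp [hK]⟩
    exact Fin.ext ((phi_inj r CharTwo.two_eq_zero hr a b a.2 b.2).1 h)
  exact ⟨Equiv.ofBijective _ hbij, fun x y => F_affine r hr x y x.2 y.2,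
    fun x => F_inf r hr x x.2⟩

theorem affine_card (K : Type*) [Field K] [Fintype K] [CharP K 2]
    (hK : Fintype.card K = 256) : Nat.card {p : K × K // F p.1 p.2 1 = 0} = 348 := by
  obtain ⟨e, he, -⟩ := exists_equiv K hK
  rw [← pair_card]
  exact (Nat.card_congr (Equiv.subtypeEquiv (e.prodCongr e) fun p => (he p.1 p.2).symm)).symm

theorem inf_card (K : Type*) [Field K] [Fintype K] [CharP K 2]
    (hK : Fintype.card K = 256) : Nat.card {x : K // F x 1 0 = 0} = 2 := by
  obtain ⟨e, -, he⟩ := exists_equiv K hK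
  rw [← inf_eq, ← Fintype.card_subtype, ← Nat.card_eq_fintype_card]
  exact (Nat.card_congr (Equiv.subtypeEquiv e fun p => (he p).symm)).symm

/-- `F₂₅₆` does not contain a root of `y³ + y² + 1` (those generate `F₈`). -/
theorem no_cubic (K : Type*) [Field K] [Fintype K] [CharP K 2]
    (hK : Fintype.card K = 256) (y : K) : y ^ 3 + y ^ 2 + 1 ≠ 0 := by
  intro h
  have h2 : (2 : K) = 0 := CharTwo.two_eq_zero
  have h0 : y ≠ 0 := by rintro rfl; simp at h
  have h7 : y ^ 7 = 1 := by
    linear_combination (y ^ 4 - y ^ 3 + y ^ 2 - 2 * y + 3) * h + (-2 * y ^ 2 + y - 2) * h2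
  have h255 : y ^ 255 = 1 := by
    have := FiniteField.pow_card_sub_one_eq_one y h0
    rwa [hK] at this
  have h3 : y ^ 3 = 1 := by
    calc y ^ 3 = (y ^ 7) ^ 36 * y ^ 3 := by rw [h7]; ring
      _ = y ^ 255 := by ring
      _ = 1 := h255
  have h1 : y = 1 := by
    calc y = (y ^ 3) ^ 2 * y := by rw [h3]; ring
      _ = y ^ 7 := by ring
      _ = 1 := h7
  rw [h1] at h
  have : (1 : K) = 0 := by linear_combination h - h2
  exact one_ne_zero this

end field

end QuinticAux

open QuinticAux in
theorem QuinticAux.eval_quintic (v : Fin 3 → GaloisField 2 8) :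
    eval v quinticF256 = F (v 0) (v 1) (v 2) := by
  simp [quinticF256, F]

theorem QuinticAux.eval_d0 (v : Fin 3 → GaloisField 2 8) :
    eval v (pderiv 0 quinticF256) = v 0 ^ 4 + v 1 ^ 4 + v 1 ^ 2 * v 2 ^ 2 + v 2 ^ 4 := by
  have h2 : (2 : GaloisField 2 8) = 0 := CharTwo.two_eq_zero
  simp [quinticF256, pderiv_X]
  grind

theorem QuinticAux.eval_d1 (v : Fin 3 → GaloisField 2 8) :
    eval v (pderiv 1 quinticF256) = v 1 ^ 4 + v 0 ^ 2 * v 2 ^ 2 := by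
  have h2 : (2 : GaloisField 2 8) = 0 := CharTwo.two_eq_zero
  simp [quinticF256, pderiv_X]
  grind

theorem QuinticAux.eval_d2 (v : Fin 3 → GaloisField 2 8) :
    eval v (pderiv 2 quinticF256) = v 0 ^ 2 * v 1 ^ 2 + v 1 ^ 4 + v 2 ^ 4 := by
  have h2 : (2 : GaloisField 2 8) = 0 := CharTwo.two_eq_zero
  simp [quinticF256, pderiv_X]
  grind

namespace QuinticAux

theorem card_gf : Nat.card (GaloisField 2 8) = 256 := by
  rw [GaloisField.card 2 8 (by norm_num)]; norm_num

/-- The curve has no singular `F₂₅₆`-point. -/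
theorem smooth (v : Fin 3 → GaloisField 2 8) (hv : v ≠ 0) :
    ∃ i, eval v (pderiv i quinticF256) ≠ 0 := by
  by_contra! h
  have h0 := h 0
  have h1 := h 1
  have h2 := h 2
  rw [eval_d0] at h0
  rw [eval_d1] at h1
  rw [eval_d2] at h2
  have two : (2 : GaloisField 2 8) = 0 := CharTwo.two_eq_zero
  let _ : Fintype (GaloisField 2 8) := Fintype.ofFinite _
  have hK : Fintype.card (GaloisField 2 8) = 256 := by
    rw [← Nat.card_eq_fintype_card, card_gf]
  have h1' : v 1 ^ 2 = v 0 * v 2 := by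
    have : (v 1 ^ 2 + v 0 * v 2) ^ 2 = 0 := by
      rw [CharTwo.add_sq]; linear_combination h1
    exact CharTwo.add_eq_zero.1 (pow_eq_zero_iff (two_ne_zero) |>.1 this)
  by_cases hz : v 2 = 0
  · rw [hz, mul_zero] at h1'
    have hy : v 1 = 0 := pow_eq_zero_iff (two_ne_zero) |>.1 h1'
    rw [hz, hy] at h0
    have hx : v 0 = 0 := by
      have : v 0 ^ 4 = 0 := by linear_combination h0
      exact pow_eq_zero_iff (by norm_num) |>.1 this
    apply hv
    funext i
    fin_cases i
    · exact hx
    · exact hy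
    · exact hz
  · refine no_cubic (GaloisField 2 8) hK (v 1 / v 2) ?_
    have h3 : (v 0 * v 1 + v 1 ^ 2 + v 2 ^ 2) ^ 2 = 0 := by
      rw [CharTwo.add_sq, CharTwo.add_sq]; linear_combination h2
    have h4 := pow_eq_zero_iff (two_ne_zero) |>.1 h3
    field_simp
    linear_combination v 2 * h4 + v 1 * h1'

theorem F_smul {K : Type*} [Field K] (a x y z : K) :
    F (a * x) (a * y) (a * z) = a ^ 5 * F x y z := by
  unfold F; ring

theorem F_rep (v : Fin 3 → GaloisField 2 8) (hv : v ≠ 0) :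
    eval (Projectivization.mk (GaloisField 2 8) v hv).rep quinticF256 = 0 ↔
      F (v 0) (v 1) (v 2) = 0 := by
  obtain ⟨a, ha⟩ := Projectivization.exists_smul_eq_mk_rep (GaloisField 2 8) v hv
  rw [← ha, eval_quintic]
  simp only [Pi.smul_apply, Units.smul_def, smul_eq_mul]
  rw [F_smul]
  simp

theorem aff_ne {K : Type*} [Field K] (x y : K) : (![x, y, 1] : Fin 3 → K) ≠ 0 := by
  intro h; simpa using congrFun h 2

theorem inf_ne {K : Type*} [Field K] (x : K) : (![x, 1, 0] : Fin 3 → K) ≠ 0 := by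
  intro h; simpa using congrFun h 1

/-- The parametrization of the points of the curve. -/
noncomputable def param :
    {p : GaloisField 2 8 × GaloisField 2 8 // F p.1 p.2 1 = 0} ⊕
      {x : GaloisField 2 8 // F x 1 0 = 0} →
    {P : Projectivization (GaloisField 2 8) (Fin 3 → GaloisField 2 8) //
      eval P.rep quinticF256 = 0 ∧ ∃ i, eval P.rep (pderiv i quinticF256) ≠ 0}
  | Sum.inl p => ⟨Projectivization.mk _ ![p.1.1, p.1.2, 1] (aff_ne _ _),
      (F_rep _ _).2 (by simpa using p.2), smooth _ (Projectivization.rep_nonzero _)⟩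
  | Sum.inr x => ⟨Projectivization.mk _ ![x.1, 1, 0] (inf_ne _),
      (F_rep _ _).2 (by simpa using x.2), smooth _ (Projectivization.rep_nonzero _)⟩

theorem param_inj : Function.Injective param := by
  rintro (⟨⟨x, y⟩, hp⟩ | ⟨x, hp⟩) (⟨⟨x', y'⟩, hp'⟩ | ⟨x', hp'⟩) h
  all_goals
    have h' := congrArg Subtype.val h
    simp only [param] at h'
    rw [Projectivization.mk_eq_mk_iff'] at h'
    obtain ⟨a, ha⟩ := h'
    have e0 := congrFun ha 0
    have e1 := congrFun ha 1
    have e2 := congrFun ha 2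
    simp at e0 e1 e2
  · subst e2
    simp at e0 e1
    simp [e0, e1]
  · rw [e2, zero_mul] at e1
    exact absurd e1 zero_ne_one
  · subst e1
    simp at e0
    simp [e0]

theorem param_surj : Function.Surjective param := by
  rintro ⟨P, hP⟩
  induction P using Projectivization.ind with
  | h v hv =>
    have hF := (F_rep v hv).1 hP.1
    by_cases hz : v 2 = 0
    · have hy : v 1 ≠ 0 := by
        intro hy
        rw [hz, hy] at hF
        have hx : v 0 = 0 := by
          have : v 0 ^ 5 = 0 := by unfold F at hF; linear_combination hF
          exact pow_eq_zero_iff (by norm_num) |>.1 this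
        apply hv
        funext i
        fin_cases i
        · exact hx
        · exact hy
        · exact hz
      refine ⟨Sum.inr ⟨v 0 / v 1, ?_⟩, ?_⟩
      · have := F_smul (v 1)⁻¹ (v 0) (v 1) (v 2)
        rw [hF, hz, inv_mul_cancel₀ hy, mul_zero, mul_zero, mul_comm] at this
        exact this
      · apply Subtype.ext
        simp only [param]
        rw [Projectivization.mk_eq_mk_iff']
        refine ⟨(v 1)⁻¹, ?_⟩
        funext i
        fin_cases i
        · simp [div_eq_inv_mul]
        · simp [hy]
        · simp [hz]
    · refine ⟨Sum.inl ⟨(v 0 / v 2, v 1 / v 2), ?_⟩, ?_⟩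
      · have := F_smul (v 2)⁻¹ (v 0) (v 1) (v 2)
        rw [hF, inv_mul_cancel₀ hz, mul_zero, mul_comm, mul_comm _ (v 1)] at this
        exact this
      · apply Subtype.ext
        simp only [param]
        rw [Projectivization.mk_eq_mk_iff']
        refine ⟨(v 2)⁻¹, ?_⟩
        funext i
        fin_cases i
        · simp [div_eq_inv_mul]
        · simp [div_eq_inv_mul]
        · simp [hz]

end QuinticAux

/-- The curve has exactly `350` smooth `F₂₅₆`-rational points. -/
theorem stmt_17 :
    Nat.card {P : Projectivization (GaloisField 2 8) (Fin 3 → GaloisField 2 8) //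
      eval P.rep quinticF256 = 0 ∧
      ∃ i, eval P.rep (pderiv i quinticF256) ≠ 0} = 350 := by
  let _ : Fintype (GaloisField 2 8) := Fintype.ofFinite _
  have hK : Fintype.card (GaloisField 2 8) = 256 := by
    rw [← Nat.card_eq_fintype_card, QuinticAux.card_gf]
  rw [← Nat.card_congr (Equiv.ofBijective _ ⟨QuinticAux.param_inj, QuinticAux.param_surj⟩),
    Nat.card_sum, QuinticAux.affine_card _ hK, QuinticAux.inf_card _ hK]
end
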